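/- arXiv:2603.17084 — 5 statements merged into one kernel-verified Lean document; each statement's English description precedes it below -/
import Mathlib

section
/- In the free group F_2 = ⟨a, b⟩, if {b, x} is a basis of F_2, then the conjugate b^x = x^{-1} b x equals b^{a^δ b^k} for some δ ∈ {1, -1} and k ∈ ℤ. Conversely, for every δ ∈ {1,-1} and k ∈ ℤ there is a basis {b, x} with b^x = b^{a^δ b^k}. -/
open Subgroup

abbrev F2 := FreeGroup (Fin 2)

def ga : F2 := FreeGroup.of 0
def gb : F2 := FreeGroup.of 1

def IsBasis (x y : F2) : Prop :=
  Function.Bijective (FreeGroup.lift ![x, y] : FreeGroup (Fin 2) →* F2)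

/-- The first and last letters of the reduced word of `g` are powers of generator `i`. -/
def Ends (i : Fin 2) (g : F2) : Prop :=
  g.toWord.head?.map Prod.fst = some i ∧ g.toWord.getLast?.map Prod.fst = some i

theorem ends_inv {i : Fin 2} {g : F2} (h : Ends i g) : Ends i g⁻¹ := by
  unfold Ends at *
  rw [FreeGroup.toWord_inv]
  simp only [FreeGroup.invRev, List.head?_reverse, List.getLast?_reverse, List.getLast?_map,
    List.head?_map, Option.map_map]
  exact ⟨h.2, h.1⟩

theorem ends_pow {i : Fin 2} {g : F2} (h : Ends i g) (n : ℕ) (hn : n ≠ 0) :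
    Ends i (g ^ n) ∧ g.norm ≤ (g ^ n).norm := by
  have hc := FreeGroup.reduceCyclically.conj_conjugator_reduceCyclically g.toWord
  have hp : (g ^ n).toWord = _ := (FreeGroup.toWord_pow g n).trans
    (FreeGroup.reduceCyclically.reduce_flatten_replicate FreeGroup.isReduced_toWord n)
  rw [if_neg hn] at hp
  generalize FreeGroup.reduceCyclically.conjugator g.toWord = C at hc hp
  generalize FreeGroup.reduceCyclically g.toWord = R at hc hp
  unfold Ends FreeGroup.norm at *
  rw [hp]
  rw [← hc] at h ⊢
  simp only [List.head?_append, List.getLast?_append, List.head?_flatten_replicate hn,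
    List.getLast?_flatten_replicate hn] at h ⊢
  refine ⟨h, ?_⟩
  simp only [List.length_append, List.length_flatten, List.map_replicate, List.sum_replicate,
    smul_eq_mul]
  have : R.length ≤ n * R.length := Nat.le_mul_of_pos_left _ (Nat.pos_of_ne_zero hn)
  omega

theorem ends_zpow {i : Fin 2} {g : F2} (h : Ends i g) (n : ℤ) (hn : n ≠ 0) :
    Ends i (g ^ n) ∧ g.norm ≤ (g ^ n).norm := by
  obtain ⟨m, rfl | rfl⟩ := n.eq_nat_or_neg
  · rw [zpow_natCast]
    exact ends_pow h m (by simpa using hn)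
  · rw [zpow_neg, zpow_natCast, FreeGroup.norm_inv_eq]
    have := ends_pow h m (by simpa using hn)
    exact ⟨ends_inv this.1, this.2⟩

theorem ends_gb : Ends 1 gb := by
  simp [Ends, gb, FreeGroup.toWord_of]

/-- No cancellation between `g` ending in `i` and `h` starting in `j ≠ i`. -/
theorem toWord_mul_of_ne {i j : Fin 2} (hij : i ≠ j) {g h : F2}
    (hg : g.toWord.getLast?.map Prod.fst = some i)
    (hh : h = 1 ∨ h.toWord.head?.map Prod.fst = some j) :
    (g * h).toWord = g.toWord ++ h.toWord := by
  rw [FreeGroup.toWord_mul, ← FreeGroup.isReduced_iff_reduce_eq]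
  unfold FreeGroup.IsReduced
  rw [List.isChain_append]
  refine ⟨FreeGroup.isReduced_toWord, FreeGroup.isReduced_toWord, ?_⟩
  intro p hp q hq hpq
  exfalso
  rcases hh with rfl | hh
  · simp at hq
  · rw [Option.mem_def] at hp hq
    rw [hp] at hg
    rw [hq] at hh
    simp at hg hh
    exact hij (by rw [← hg, ← hh, hpq])

/-- Alternating products of nonzero powers of `b` and `y`; the index `true` means that the product
is empty or starts with a power of `y`, and `false` that it is empty or starts with a power
of `b`. -/
inductive Alt (y : F2) : Bool → F2 → Prop
  | nil (s : Bool) : Alt y s 1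
  | consb (k : ℤ) (g : F2) : k ≠ 0 → Alt y true g → Alt y false (gb ^ k * g)
  | consy (k : ℤ) (g : F2) : k ≠ 0 → Alt y false g → Alt y true (y ^ k * g)

theorem alt_mul_b {y : F2} (m : ℤ) {s : Bool} {g : F2} (h : Alt y s g) :
    ∃ t, Alt y t (gb ^ m * g) := by
  by_cases hm : m = 0
  · subst hm
    exact ⟨s, by simpa using h⟩
  cases h with
  | nil => exact ⟨false, Alt.consb m 1 hm (Alt.nil true)⟩
  | consb k g hk hg =>
    rw [← mul_assoc, ← zpow_add]
    by_cases h0 : m + k = 0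
    · rw [h0]
      exact ⟨true, by simpa using hg⟩
    · exact ⟨false, Alt.consb _ g h0 hg⟩
  | consy k g hk hg => exact ⟨false, Alt.consb m _ hm (Alt.consy k g hk hg)⟩

theorem alt_mul_y {y : F2} (m : ℤ) {s : Bool} {g : F2} (h : Alt y s g) :
    ∃ t, Alt y t (y ^ m * g) := by
  by_cases hm : m = 0
  · subst hm
    exact ⟨s, by simpa using h⟩
  cases h with
  | nil => exact ⟨true, Alt.consy m 1 hm (Alt.nil false)⟩
  | consy k g hk hg =>
    rw [← mul_assoc, ← zpow_add]
    by_cases h0 : m + k = 0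
    · rw [h0]
      exact ⟨false, by simpa using hg⟩
    · exact ⟨true, Alt.consy _ g h0 hg⟩
  | consb k g hk hg => exact ⟨true, Alt.consy m _ hm (Alt.consb k g hk hg)⟩

theorem alt_of_mem {y g : F2} (h : g ∈ Subgroup.closure ({gb, y} : Set F2)) :
    ∃ t, Alt y t g := by
  induction h using Subgroup.closure_induction_left with
  | one => exact ⟨true, Alt.nil true⟩
  | mul_left x hx z _ ih =>
    obtain ⟨t, ht⟩ := ih
    rcases hx with rfl | rfl
    · simpa using alt_mul_b 1 ht
    · simpa using alt_mul_y 1 ht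
  | inv_mul_cancel x hx z _ ih =>
    obtain ⟨t, ht⟩ := ih
    rcases hx with rfl | rfl
    · simpa using alt_mul_b (-1) ht
    · simpa using alt_mul_y (-1) ht

theorem alt_inv {y : F2} (hy : Ends 0 y) {s : Bool} {g : F2} (h : Alt y s g) :
    g = 1 ∨ (g.toWord.head?.map Prod.fst = some (if s then 0 else 1) ∧
      (s = true → y.norm ≤ g.norm)) := by
  induction h with
  | nil => exact Or.inl rfl
  | consb k g hk hg ih =>
    right
    have e := (ends_zpow ends_gb k hk).1
    have w := toWord_mul_of_ne (i := 1) (j := 0) (by decide) e.2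
      (ih.imp id (fun h => by simpa using h.1))
    rw [w, List.head?_append]
    have e1 := e.1
    cases hh : (gb ^ k).toWord.head? with
    | none => simp [hh] at e1
    | some p => simpa [hh] using e1
  | consy k g hk hg ih =>
    right
    have e' := ends_zpow hy k hk
    have e := e'.1
    have w := toWord_mul_of_ne (i := 0) (j := 1) (by decide) e.2
      (ih.imp id (fun h => by simpa using h.1))
    have e2 := e'.2
    unfold FreeGroup.norm at e2 ⊢
    rw [w, List.head?_append, List.length_append]
    refine ⟨?_, fun _ => by omega⟩
    have e1 := e.1
    cases hh : (y ^ k).toWord.head? with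
    | none => simp [hh] at e1
    | some p => simpa [hh] using e1

theorem core_eq {y : F2} (hy : Ends 0 y) (h : ga ∈ Subgroup.closure ({gb, y} : Set F2)) :
    y = ga ∨ y = ga⁻¹ := by
  obtain ⟨t, ht⟩ := alt_of_mem h
  have hn : y.norm ≤ 1 := by
    rcases alt_inv hy ht with h1 | ⟨h1, h2⟩
    · exact absurd h1 (FreeGroup.of_ne_one _)
    · cases t
      · simp [ga, FreeGroup.toWord_of] at h1
      · simpa [ga] using h2 rfl
  have e := hy.1
  have hm : FreeGroup.mk y.toWord = y := FreeGroup.mk_toWord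
  unfold FreeGroup.norm at hn
  match hw : y.toWord with
  | [] => simp [hw] at e
  | [(i, s)] =>
    simp [hw] at e
    subst e
    rw [← hm, hw]
    cases s
    · right; rfl
    · left; rfl
  | _ :: _ :: _ => simp [hw] at hn

theorem mk_one_letter (s : Bool) :
    FreeGroup.mk [((1 : Fin 2), s)] = gb ^ (if s then (1 : ℤ) else -1) := by
  cases s
  · simp [gb]; rfl
  · simp [gb]; rfl

theorem decomp (n : ℕ) : ∀ x : F2, x.norm ≤ n →
    ∃ (i j : ℤ) (y : F2), x = gb ^ i * y * gb ^ j ∧ (y = 1 ∨ Ends 0 y) := by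
  induction n with
  | zero =>
    intro x hx
    have : x = 1 := FreeGroup.norm_eq_zero.1 (by omega)
    exact ⟨0, 0, 1, by simp [this], Or.inl rfl⟩
  | succ n ih =>
    intro x hx
    have hm : FreeGroup.mk x.toWord = x := FreeGroup.mk_toWord
    have hx' : x.toWord.length ≤ n + 1 := hx
    rcases List.eq_nil_or_concat x.toWord with h0 | ⟨L, ⟨i, s⟩, hL⟩
    · exact ⟨0, 0, 1, by simp [FreeGroup.toWord_eq_nil_iff.1 h0], Or.inl rfl⟩
    by_cases hi : i = 1
    · subst hi
      obtain ⟨p, q, y, hy, hy'⟩ := ih (FreeGroup.mk L)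
        (FreeGroup.norm_mk_le.trans (by simp [hL] at hx'; omega))
      refine ⟨p, q + (if s then (1 : ℤ) else -1), y, ?_, hy'⟩
      rw [← hm, hL, zpow_add, ← mul_assoc, ← hy, ← mk_one_letter, FreeGroup.mul_mk,
        List.concat_eq_append]
    have hi0 : i = 0 := by omega
    cases hw : x.toWord with
    | nil => simp [hw] at hL
    | cons c K =>
      obtain ⟨j, r⟩ := c
      by_cases hj : j = 1
      · subst hj
        obtain ⟨p, q, y, hy, hy'⟩ := ih (FreeGroup.mk K)
          (FreeGroup.norm_mk_le.trans (by simp [hw] at hx'; omega))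
        refine ⟨(if r then (1 : ℤ) else -1) + p, q, y, ?_, hy'⟩
        rw [← hm, hw, zpow_add, mul_assoc, mul_assoc, ← mul_assoc (gb ^ p), ← hy,
          ← mk_one_letter, FreeGroup.mul_mk]
        rfl
      · have hj0 : j = 0 := by omega
        refine ⟨0, 0, x, by simp, Or.inr ⟨?_, ?_⟩⟩
        · simp [hw, hj0]
        · simp [hL, hi0]

theorem mem_closure_of_basis {x y : F2} {i j : ℤ} (h : IsBasis gb x)
    (hx : x = gb ^ i * y * gb ^ j) : ga ∈ Subgroup.closure ({gb, y} : Set F2) := by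
  have h1 : (FreeGroup.lift ![gb, x]).range ≤ Subgroup.closure ({gb, y} : Set F2) := by
    apply FreeGroup.range_lift_le
    have hb : gb ∈ Subgroup.closure ({gb, y} : Set F2) := Subgroup.subset_closure (by simp)
    have hy : y ∈ Subgroup.closure ({gb, y} : Set F2) := Subgroup.subset_closure (by simp)
    rintro _ ⟨k, rfl⟩
    fin_cases k
    · exact hb
    · change x ∈ Subgroup.closure ({gb, y} : Set F2)
      rw [hx]
      exact mul_mem (mul_mem (zpow_mem hb _) hy) (zpow_mem hb _)
  exact h1 (h.2 ga)

theorem ga_not_mem : ga ∉ Subgroup.closure ({gb, 1} : Set F2) := by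
  intro h
  let f : F2 →* Multiplicative ℤ := FreeGroup.lift ![Multiplicative.ofAdd 1, 1]
  have h1 : Subgroup.closure ({gb, 1} : Set F2) ≤ f.ker := by
    rw [Subgroup.closure_le]
    rintro _ (rfl | rfl)
    · simp [f, gb, MonoidHom.mem_ker]
    · exact one_mem _
  have h2 := h1 h
  simp [f, ga, MonoidHom.mem_ker] at h2

theorem basis_conv (δ k : ℤ) (hδ : δ = 1 ∨ δ = -1) : IsBasis gb (ga ^ δ * gb ^ k) := by
  have hd : δ * δ = 1 := by rcases hδ with rfl | rfl <;> rfl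
  let φ : F2 →* F2 := FreeGroup.lift ![gb, ga ^ δ * gb ^ k]
  let ψ : F2 →* F2 := FreeGroup.lift ![(gb * ga ^ (-k)) ^ δ, ga]
  have a1 : φ ga = gb := by simp [φ, ga]
  have a2 : φ gb = ga ^ δ * gb ^ k := by simp [φ, gb]
  have b1 : ψ ga = (gb * ga ^ (-k)) ^ δ := by simp [ψ, ga]
  have b2 : ψ gb = ga := by simp [ψ, gb]
  have e1 : φ.comp ψ = MonoidHom.id F2 := by
    ext i
    fin_cases i
    · change φ (ψ ga) = ga
      rw [b1, map_zpow, map_mul, map_zpow, a1, a2, mul_assoc, ← zpow_add, add_neg_cancel, zpow_zero,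
        mul_one, ← zpow_mul, hd, zpow_one]
    · change φ (ψ gb) = gb
      rw [b2, a1]
  have e2 : ψ.comp φ = MonoidHom.id F2 := by
    ext i
    fin_cases i
    · change ψ (φ ga) = ga
      rw [a1, b2]
    · change ψ (φ gb) = gb
      rw [a2, map_mul, map_zpow, map_zpow, b1, b2, ← zpow_mul, hd, zpow_one, mul_assoc, ← zpow_add,
        neg_add_cancel, zpow_zero, mul_one]
  exact Function.bijective_iff_has_inverse.2
    ⟨ψ, fun z => DFunLike.congr_fun e2 z, fun z => DFunLike.congr_fun e1 z⟩

/-- If `{b, x}` is a basis of `F2`, then `b^x = b^{a^δ b^k}` for some `δ ∈ {1, -1}`,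
`k ∈ ℤ`; conversely, every such conjugate arises this way from a basis `{b, x}`. -/
theorem one_conjugates_of_b :
    (∀ x : F2, IsBasis gb x →
      ∃ (δ k : ℤ), (δ = 1 ∨ δ = -1) ∧
        x⁻¹ * gb * x = (ga ^ δ * gb ^ k)⁻¹ * gb * (ga ^ δ * gb ^ k)) ∧
    (∀ (δ k : ℤ), (δ = 1 ∨ δ = -1) →
      ∃ x : F2, IsBasis gb x ∧
        x⁻¹ * gb * x = (ga ^ δ * gb ^ k)⁻¹ * gb * (ga ^ δ * gb ^ k)) := by
  refine ⟨?_, fun δ k hδ => ⟨_, basis_conv δ k hδ, rfl⟩⟩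
  intro x hx
  obtain ⟨i, j, y, hxy, hy⟩ := decomp _ x le_rfl
  have hmem := mem_closure_of_basis hx hxy
  rcases hy with rfl | hy
  · exact absurd hmem ga_not_mem
  have key : ∃ δ : ℤ, (δ = 1 ∨ δ = -1) ∧ y = ga ^ δ := by
    rcases core_eq hy hmem with h | h
    · exact ⟨1, Or.inl rfl, by simpa using h⟩
    · exact ⟨-1, Or.inr rfl, by simpa using h⟩
  obtain ⟨δ, hδ, rfl⟩ := key
  refine ⟨δ, j, hδ, ?_⟩
  rw [hxy]
  group
end

section
/- Let F_2 = ⟨a, b⟩ and let x, y, z ∈ F_2 be pairwise non-equal primitive elements (as cyclic subgroups ⟨x⟩, ⟨y⟩, ⟨z⟩ distinct) that are pairwise conjugate in F_2. Then there is at most one cyclic subgroup ⟨t⟩ such that each of {x, t}, {y, t}, {z, t} is a basis of F_2 (up to replacing generators by their inverses). -/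
open Subgroup

def Primitive (x : F2) : Prop := ∃ y : F2, IsBasis x y

open FreeGroup in
/-- The word computation behind the key fact. -/
theorem word_image (U : List (Fin 2 × Bool)) (C : Bool → List (Fin 2 × Bool)) (w : F2)
    (hw : ∀ e, mk (U ++ C e ++ invRev U) = cond e w w⁻¹)
    (hne : ∀ e, C e ≠ [])
    (hr : ∀ e, IsReduced (U ++ C e ++ invRev U))
    (hcc : ∀ e, IsReduced (C e ++ C e))
    (hhd : ∀ e, ∃ f S, U ++ C e = (1, f) :: S)
    (hla : ∀ e, ∃ f S, U ++ C e ++ invRev U = S ++ [(1, f)])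
    (L : List (Fin 2 × Bool)) (hL : IsReduced L) :
    ∃ R, IsReduced R ∧ mk R = FreeGroup.lift ![of 0, w] (mk L) ∧
      (L = [] → R = []) ∧
      (∀ e L', L = (0, e) :: L' → ∃ R', R = (0, e) :: R') ∧
      (∀ e L', L = (1, e) :: L' → ∃ R', R = U ++ C e ++ R') := by
  induction L with
  | nil => exact ⟨[], by simp, by simp [← one_eq_mk], by simp, by simp, by simp⟩
  | cons p L ih =>
    obtain ⟨i, e⟩ := p
    obtain ⟨R, hR, hRm, h0, h1, h2⟩ := ih (hL.infix ⟨[(i, e)], [], by simp⟩)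
    have hcons : (mk ((i, e) :: L) : F2) = mk [(i, e)] * mk L := by simp
    rw [hcons, _root_.map_mul, ← hRm]
    have hi : i = 0 ∨ i = 1 := by omega
    rcases hi with rfl | rfl
    · refine ⟨(0, e) :: R, ?_, ?_, by simp, by simp, by simp⟩
      · rcases L with _ | ⟨⟨j, e'⟩, L⟩
        · simp [h0 rfl]
        · have hj : j = 0 ∨ j = 1 := by omega
          rcases hj with rfl | rfl
          · obtain ⟨R', rfl⟩ := h1 e' L rfl
            rw [isReduced_cons_cons] at hL ⊢
            exact ⟨hL.1, hR⟩
          · obtain ⟨R', rfl⟩ := h2 e' L rfl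
            obtain ⟨f, S, hS⟩ := hhd e'
            rw [hS, List.cons_append] at hR ⊢
            rw [isReduced_cons_cons]
            exact ⟨by simp, hR⟩
      · have : (mk ((0, e) :: R) : F2) = mk [(0, e)] * mk R := by simp
        rw [this]
        congr 1
        cases e <;> simp [of, inv_mk, invRev]
    · have hm : FreeGroup.lift ![of 0, w] (mk [((1 : Fin 2), e)]) = cond e w w⁻¹ := by
        cases e <;> simp
      rw [hm, ← hw e]
      rcases L with _ | ⟨⟨j, e'⟩, L⟩
      · refine ⟨U ++ C e ++ invRev U, hr e, by simp [h0 rfl, ← one_eq_mk], by simp, by simp, ?_⟩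
        intro e' L' h
        simp only [List.cons.injEq, Prod.mk.injEq, true_and] at h
        obtain ⟨rfl, -⟩ := h
        exact ⟨_, rfl⟩
      · have hj : j = 0 ∨ j = 1 := by omega
        rcases hj with rfl | rfl
        · refine ⟨U ++ C e ++ invRev U ++ R, ?_, by simp, by simp, by simp, ?_⟩
          · obtain ⟨R', rfl⟩ := h1 e' L rfl
            obtain ⟨f, S, hS⟩ := hla e
            have h3 := hr e
            rw [hS] at h3 ⊢
            refine IsReduced.append_overlap h3 ?_ (by simp)
            rw [List.singleton_append, isReduced_cons_cons]
            exact ⟨by simp, hR⟩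
          · intro e' L' h
            simp only [List.cons.injEq, Prod.mk.injEq, true_and] at h
            obtain ⟨rfl, -⟩ := h
            exact ⟨invRev U ++ R, by simp⟩
        · rw [isReduced_cons_cons] at hL
          have he : e = e' := hL.1 rfl
          subst he
          obtain ⟨R', rfl⟩ := h2 e L rfl
          refine ⟨U ++ C e ++ (C e ++ R'), ?_, ?_, ?_, by simp, ?_⟩
          · rw [← List.append_assoc]
            refine IsReduced.append_overlap ?_ (hR.infix ⟨U, [], by simp⟩) (hne e)
            exact IsReduced.append_overlap (hR.infix ⟨[], R', by simp⟩) (hcc e) (hne e)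
          · simp only [← mul_mk, ← inv_mk]
            group
          · simp
          · intro e' L' h
            simp only [List.cons.injEq, Prod.mk.injEq, true_and] at h
            obtain ⟨rfl, -⟩ := h
            exact ⟨_, rfl⟩

open FreeGroup in
theorem key_base (w : F2) (hw : w ≠ 1)
    (hh : ∃ f S, w.toWord = ((1 : Fin 2), f) :: S) (hl : ∃ f S, w.toWord = S ++ [((1 : Fin 2), f)])
    (hb : ∃ g : F2, FreeGroup.lift ![of 0, w] g = of 1) : w = of 1 ∨ w = (of 1)⁻¹ := by
  obtain ⟨g, hg⟩ := hb
  set U := reduceCyclically.conjugator w.toWord with hU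
  set c := reduceCyclically w.toWord with hc
  have hdec : U ++ c ++ invRev U = w.toWord :=
    reduceCyclically.conj_conjugator_reduceCyclically w.toWord
  have hdec' : U ++ invRev c ++ invRev U = invRev w.toWord := by
    rw [← hdec]; simp [invRev, Function.comp_def]
  have hcr : IsCyclicallyReduced c := reduceCyclically.isCyclicallyReduced isReduced_toWord
  have hcne : c ≠ [] := by
    intro h
    apply hw
    rw [← mk_toWord (x := w), ← hdec, h]
    simp only [← mul_mk, ← inv_mk, ← one_eq_mk]
    group
  have hrw : IsReduced (invRev w.toWord) := by
    rw [← toWord_inv]; exact isReduced_toWord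
  have hcc : IsReduced (c ++ c) := by
    have := (hcr.flatten_replicate 2).isReduced
    simpa [List.replicate] using this
  have hhead : ∀ (V D X : List (Fin 2 × Bool)) (f S), D ≠ [] → V ++ D ++ X = ((1 : Fin 2), f) :: S →
      ∃ f S, V ++ D = ((1 : Fin 2), f) :: S := by
    intro V D X f S hD h
    rcases hVD : V ++ D with _ | ⟨p, T⟩
    · simp at hVD; exact absurd hVD.2 hD
    · rw [hVD] at h
      simp at h
      exact ⟨f, T, by rw [h.1]⟩
  obtain ⟨f1, S1, h1⟩ := hh
  obtain ⟨f2, S2, h2⟩ := hl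
  have hicne : invRev c ≠ [] := by
    intro h; apply hcne; simpa [invRev] using h
  obtain ⟨R, hR, hRm, r0, r1, r2⟩ := word_image U (fun e => cond e c (invRev c)) w
    (by
      rintro (_ | _)
      · simp only [cond_false]; rw [hdec', ← inv_mk, mk_toWord]
      · simp only [cond_true]; rw [hdec, mk_toWord])
    (by rintro (_ | _) <;> simpa)
    (by
      rintro (_ | _)
      · simp only [cond_false]; rw [hdec']; exact hrw
      · simp only [cond_true]; rw [hdec]; exact isReduced_toWord)
    (by
      rintro (_ | _)
      · simp only [cond_false]
        have : invRev c ++ invRev c = invRev (c ++ c) := by simp [invRev]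
        rw [this, isReduced_iff_reduce_eq, reduce_invRev, hcc.reduce_eq]
      · exact hcc)
    (by
      rintro (_ | _)
      · exact hhead _ _ (invRev U) (!f2) (invRev S2) hicne (by simp only [cond_false]; rw [hdec', h2]; simp [invRev])
      · exact hhead _ _ (invRev U) f1 S1 hcne (by simp only [cond_true]; rw [hdec, h1]))
    (by
      rintro (_ | _)
      · exact ⟨!f1, invRev S1, by simp only [cond_false]; rw [hdec', h1]; simp [invRev]⟩
      · exact ⟨f2, S2, by simp only [cond_true]; rw [hdec, h2]⟩)
    g.toWord isReduced_toWord
  rw [mk_toWord, hg] at hRm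
  have hR1 : R = [(1, true)] := by
    rw [← hR.reduce_eq, ← toWord_mk, hRm, toWord_of]
  rcases hgw : g.toWord with _ | ⟨⟨j, e⟩, L⟩
  · rw [r0 hgw] at hR1; simp at hR1
  · have hj : j = 0 ∨ j = 1 := by omega
    rcases hj with rfl | rfl
    · obtain ⟨R', h⟩ := r1 e L hgw
      rw [hR1] at h; simp at h
    · obtain ⟨R', h⟩ := r2 e L hgw
      rw [hR1] at h
      have hU0 : U = [] := by
        rcases hUU : U with _ | ⟨p, T⟩
        · rfl
        · rw [hUU] at h
          exfalso
          simp only [List.cons_append, List.cons.injEq] at h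
          have h3 := h.2.symm
          simp only [List.append_eq_nil_iff] at h3
          cases e
          · exact hicne h3.1.2
          · exact hcne h3.1.2
      have hce : cond e c (invRev c) = [(1, true)] := by
        rw [hU0] at h
        rcases hD : cond e c (invRev c) with _ | ⟨p, T⟩
        · cases e <;> simp_all
        · rw [hD] at h
          simp at h
          rw [← h.1, h.2.1]
      cases e
      · right
        rw [← inv_inj, inv_inv, ← mk_toWord (x := w), inv_mk, ← hdec', hU0]
        simp only [cond_false] at hce
        rw [hce]; rfl
      · left
        rw [← mk_toWord (x := w), ← hdec, hU0]
        simp only [cond_true] at hce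
        rw [hce]; rfl

open FreeGroup in
theorem gen_shift (w w' : F2) (i j : ℤ) (h : w = of 0 ^ i * w' * of 0 ^ j)
    (hb : ∃ g : F2, FreeGroup.lift ![of 0, w] g = of 1) :
    ∃ g : F2, FreeGroup.lift ![of 0, w'] g = of 1 := by
  obtain ⟨g, hg⟩ := hb
  refine ⟨FreeGroup.lift ![of 0, of 0 ^ i * of 1 * of 0 ^ j] g, ?_⟩
  have : (FreeGroup.lift ![of 0, w']).comp
      (FreeGroup.lift ![of 0, of 0 ^ i * of 1 * of 0 ^ j] : F2 →* F2)
      = (FreeGroup.lift ![of 0, w] : F2 →* F2) := by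
    ext k
    fin_cases k
    · simp
    · simp [h]
  exact (DFunLike.congr_fun this g).trans hg

open FreeGroup in
theorem letter_zpow (f : Bool) : ∃ k : ℤ, (mk [((0 : Fin 2), f)] : F2) = of 0 ^ k := by
  cases f
  · exact ⟨-1, by simp [of, inv_mk, invRev]⟩
  · exact ⟨1, by simp [of]⟩

open FreeGroup in
theorem key_ind (n : ℕ) (w : F2) (hn : w.toWord.length ≤ n)
    (hb : ∃ g : F2, FreeGroup.lift ![of 0, w] g = of 1) :
    ∃ i j : ℤ, w = of 0 ^ i * of 1 * of 0 ^ j ∨ w = of 0 ^ i * (of 1)⁻¹ * of 0 ^ j := by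
  induction n generalizing w with
  | zero =>
    exfalso
    have hw : w = 1 := by
      rw [← toWord_eq_nil_iff]
      exact List.length_eq_zero_iff.1 (by omega)
    subst hw
    obtain ⟨g, hg⟩ := hb
    have : ((FreeGroup.lift ![1, Multiplicative.ofAdd (1 : ℤ)]).comp
        (FreeGroup.lift ![of 0, 1] : F2 →* F2)) = 1 := by
      ext k
      fin_cases k <;> simp
    have h2 := DFunLike.congr_fun this g
    rw [MonoidHom.comp_apply, hg] at h2
    simp at h2
  | succ n ih =>
    by_cases hw : w = 1
    · exact ih w (by simp [hw]) hb
    have hne : w.toWord ≠ [] := by rwa [Ne, toWord_eq_nil_iff]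
    obtain ⟨⟨p, f⟩, S, hS⟩ := List.exists_cons_of_ne_nil hne
    obtain ⟨S', ⟨q, f'⟩, hS'⟩ : ∃ S' q, w.toWord = S' ++ [q] :=
      ⟨_, _, (List.dropLast_append_getLast hne).symm⟩
    have hred : FreeGroup.IsReduced w.toWord := isReduced_toWord
    have hp : p = 0 ∨ p = 1 := by omega
    have hq : q = 0 ∨ q = 1 := by omega
    rcases hp with rfl | rfl
    · obtain ⟨k, hk⟩ := letter_zpow f
      have hw' : w = of 0 ^ k * mk S * of 0 ^ (0 : ℤ) := by
        rw [← mk_toWord (x := w), hS, ← hk]; simp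
      have hSr : FreeGroup.IsReduced S := hred.infix ⟨[(0, f)], [], by simp [hS]⟩
      obtain ⟨i, j, h⟩ := ih (mk S) (by
        rw [toWord_mk, hSr.reduce_eq]
        rw [hS] at hn; simpa using hn) (gen_shift w _ _ _ hw' hb)
      refine ⟨k + i, j, ?_⟩
      rcases h with h | h
      · left; rw [hw', h]; group
      · right; rw [hw', h]; group
    rcases hq with rfl | rfl
    · obtain ⟨k, hk⟩ := letter_zpow f'
      have hw' : w = of 0 ^ (0 : ℤ) * mk S' * of 0 ^ k := by
        rw [← mk_toWord (x := w), hS', ← hk]; simp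
      have hSr : FreeGroup.IsReduced S' := hred.infix ⟨[], [(0, f')], by simp [hS']⟩
      obtain ⟨i, j, h⟩ := ih (mk S') (by
        rw [toWord_mk, hSr.reduce_eq]
        rw [hS'] at hn; simpa using hn) (gen_shift w _ _ _ hw' hb)
      refine ⟨i, j + k, ?_⟩
      rcases h with h | h
      · left; rw [hw', h]; group
      · right; rw [hw', h]; group
    refine ⟨0, 0, ?_⟩
    simpa using key_base w hw ⟨f, S, hS⟩ ⟨f', S', hS'⟩ hb

open FreeGroup in
/-- If `{x, t}` and `{x, u}` are bases, then `u = x^i t^{±1} x^j`. -/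
theorem key (x t u : F2) (ht : IsBasis x t) (hu : IsBasis x u) :
    ∃ i j : ℤ, u = x ^ i * t * x ^ j ∨ u = x ^ i * t⁻¹ * x ^ j := by
  obtain ⟨w, hw⟩ := ht.2 u
  obtain ⟨g, hg⟩ := hu.2 t
  have hcomp : (FreeGroup.lift ![x, t] : F2 →* F2).comp (FreeGroup.lift ![of 0, w])
      = (FreeGroup.lift ![x, u] : F2 →* F2) := by
    ext k
    fin_cases k
    · simp
    · simp [hw]
  obtain ⟨i, j, h⟩ := key_ind _ w le_rfl ⟨g, by
    apply ht.1
    have := DFunLike.congr_fun hcomp g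
    rw [MonoidHom.comp_apply] at this
    rw [this, hg]; simp⟩
  refine ⟨i, j, ?_⟩
  rcases h with h | h
  · left; rw [← hw, h]; simp
  · right; rw [← hw, h]; simp

open FreeGroup in
theorem IsBasis.swap {x t : F2} (h : IsBasis x t) : IsBasis t x := by
  have hc : (FreeGroup.lift ![t, x] : F2 →* F2)
      = (FreeGroup.lift ![x, t] : F2 →* F2).comp
        (FreeGroup.freeGroupCongr (Equiv.swap (0 : Fin 2) 1)).toMonoidHom := by
    ext k
    fin_cases k <;> simp
  unfold IsBasis
  rw [hc]
  exact h.comp (FreeGroup.freeGroupCongr (Equiv.swap (0 : Fin 2) 1)).bijective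

open FreeGroup in
theorem IsBasis.exists_hom {x t : F2} (h : IsBasis x t) {G : Type*} [Group G] (A B : G) :
    ∃ f : F2 →* G, f x = A ∧ f t = B := by
  obtain ⟨e, he⟩ : ∃ e : F2 ≃* F2, ∀ g, e g = (FreeGroup.lift ![x, t] : F2 →* F2) g :=
    ⟨MulEquiv.ofBijective (FreeGroup.lift ![x, t] : F2 →* F2) h, fun g => rfl⟩
  have hx : e.symm x = of 0 := by
    rw [MulEquiv.symm_apply_eq, he]; simp
  have ht : e.symm t = of 1 := by
    rw [MulEquiv.symm_apply_eq, he]; simp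
  refine ⟨(FreeGroup.lift ![A, B]).comp e.symm.toMonoidHom, ?_, ?_⟩
  · simp [hx]
  · simp [ht]

theorem conj_form {x y t : F2} (hx : IsBasis x t) (hy : IsBasis y t) (c : IsConj x y) :
    ∃ m : ℤ, y = t ^ m * x * (t ^ m)⁻¹ := by
  obtain ⟨i, j, h⟩ := key t x y hx.swap hy.swap
  obtain ⟨g, hg⟩ := isConj_iff.1 c
  obtain ⟨f1, h1x, h1t⟩ := hx.exists_hom (Multiplicative.ofAdd (1 : ℤ)) 1
  obtain ⟨f2, h2x, h2t⟩ := hx.exists_hom 1 (Multiplicative.ofAdd (1 : ℤ))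
  have e1 : f1 y = Multiplicative.ofAdd (1 : ℤ) := by
    rw [← hg, map_mul, map_mul, map_inv, mul_inv_cancel_comm, h1x]
  have e2 : f2 y = 1 := by
    rw [← hg, map_mul, map_mul, map_inv, mul_inv_cancel_comm, h2x]
  refine ⟨i, ?_⟩
  rcases h with h | h
  · rw [h] at e2
    simp only [map_mul, map_zpow, h2x, h2t, mul_one, ← zpow_add] at e2
    have : i + j = 0 := by
      have := congrArg Multiplicative.toAdd e2
      simpa using this
    have hj : j = -i := by omega
    rw [h, hj, zpow_neg]
  · exfalso
    rw [h] at e1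
    simp only [map_mul, map_zpow, map_inv, h1x, h1t, one_zpow, mul_one, one_mul] at e1
    have := congrArg Multiplicative.toAdd e1
    simp at this

/-- Affine action: if the conjugates agree then the fixed points agree. -/
theorem fixed_pt {x t : F2} (h : IsBasis x t) (i j m m' : ℤ)
    (he : t ^ m * x * (t ^ m)⁻¹ =
      (x ^ i * t * x ^ j) ^ m' * x * ((x ^ i * t * x ^ j) ^ m')⁻¹)
    (l : ℝ) (hl : 0 < l) :
    l ^ i * (l ^ ((i + j) * m') - 1) = m * (l ^ (i + j) - 1) ∧
    (l ≠ 1 → i + j = 0 → l ^ i * m' = m) := by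
  by_cases hl1 : l = 1
  · subst hl1; simp
  obtain ⟨f, hx, ht⟩ := h.exists_hom (G := Equiv.Perm ℝ) (Equiv.mulLeft₀ l hl.ne') (Equiv.addRight 1)
  have hxz : ∀ (n : ℤ) v, (f x ^ n) v = l ^ n * v := by
    intro n
    induction n using Int.induction_on with
    | zero => simp
    | succ n ih =>
      intro v
      rw [zpow_add_one, Equiv.Perm.mul_apply, ih, hx, zpow_add_one₀ hl.ne']
      simp [mul_assoc]
    | pred n ih =>
      intro v
      rw [zpow_sub_one, Equiv.Perm.mul_apply, ih, zpow_sub_one₀ hl.ne', hx]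
      have : (Equiv.mulLeft₀ l hl.ne')⁻¹ v = l⁻¹ * v := by
        rw [Equiv.Perm.inv_eq_iff_eq]; simp [hl.ne']
      rw [this, mul_assoc]
  have htz : ∀ (n : ℤ) v, (f t ^ n) v = v + n := by
    intro n v
    rw [ht]
    simp
  set T := f (x ^ i * t * x ^ j) with hT
  have hTv : ∀ v, T v = l ^ (i + j) * v + l ^ i := by
    intro v
    rw [hT, map_mul, map_mul, map_zpow, map_zpow, Equiv.Perm.mul_apply, Equiv.Perm.mul_apply,
      hxz, hxz, ht, zpow_add₀ hl.ne']
    simp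
    ring
  set q := l ^ (i + j) with hq
  have hq0 : q ≠ 0 := by positivity
  have hTi : ∀ v, T (T⁻¹ v) = v := fun v => by simp
  have hTz : ∀ (n : ℤ) v, (q - 1) * (T ^ n) v + l ^ i = q ^ n * ((q - 1) * v + l ^ i) := by
    intro n
    induction n using Int.induction_on with
    | zero => simp
    | succ n ih =>
      intro v
      rw [zpow_add_one, Equiv.Perm.mul_apply, ih, hTv, zpow_add_one₀ hq0]
      ring
    | pred n ih =>
      intro v
      rw [zpow_sub_one, Equiv.Perm.mul_apply, ih, zpow_sub_one₀ hq0]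
      have := hTi v
      rw [hTv] at this
      generalize T⁻¹ v = p at this ⊢
      rw [← this]
      field_simp
      ring
  have hTz1 : i + j = 0 → ∀ (n : ℤ) v, (T ^ n) v = v + n * l ^ i := by
    intro h0 n
    have hq1 : q = 1 := by simp [hq, h0]
    induction n using Int.induction_on with
    | zero => simp
    | succ n ih =>
      intro v
      rw [zpow_add_one, Equiv.Perm.mul_apply, ih, hTv, hq1]
      push_cast
      ring
    | pred n ih =>
      intro v
      rw [zpow_sub_one, Equiv.Perm.mul_apply, ih]
      have := hTi v
      rw [hTv, hq1] at this
      push_cast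
      linarith
  have hfix : (T ^ m') 0 = m := by
    have h1 := congrArg f he
    simp only [map_mul, map_zpow, map_inv] at h1
    have h2 := DFunLike.congr_fun h1 (m : ℝ)
    have h3 : (f t ^ m)⁻¹ (m : ℝ) = 0 := by
      rw [Equiv.Perm.inv_eq_iff_eq, htz]; simp
    rw [Equiv.Perm.mul_apply, Equiv.Perm.mul_apply, h3, hx] at h2
    have hT' : f x ^ i * f t * f x ^ j = T := by simp [hT]
    rw [← hx, hT', Equiv.Perm.mul_apply, Equiv.Perm.mul_apply] at h2
    have h4 : f x 0 = 0 := by rw [hx]; simp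
    rw [h4, htz, zero_add] at h2
    have h5 : (T ^ m')⁻¹ (m : ℝ) = f x ((T ^ m')⁻¹ (m : ℝ)) := by
      rw [Equiv.Perm.inv_eq_iff_eq]; exact h2
    set p := (T ^ m')⁻¹ (m : ℝ) with hp
    rw [hx] at h5
    change p = l * p at h5
    have h6 : p = 0 := by
      have : (l - 1) * p = 0 := by linarith
      rcases mul_eq_zero.1 this with h | h
      · exact absurd (by linarith) hl1
      · exact h
    rw [← h6, hp]; simp
  constructor
  · have := hTz m' 0
    rw [hfix, hq, ← zpow_mul, ← hq] at this
    linarith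
  · intro _ h0
    have := hTz1 h0 m' 0
    rw [hfix] at this
    linarith

theorem exp_eq {x t : F2} (h : IsBasis x t) (i j m m' : ℤ) (hij : i + j ≠ 0)
    (he : t ^ m * x * (t ^ m)⁻¹ =
      (x ^ i * t * x ^ j) ^ m' * x * ((x ^ i * t * x ^ j) ^ m')⁻¹) : m' = m := by
  have h1 := fun l hl => (fixed_pt h i j m m' he l hl).1
  have d1 : HasDerivAt (fun l : ℝ => l ^ i * (l ^ ((i + j) * m') - 1))
      (((i + j) * m' : ℤ) : ℝ) 1 := by
    have a1 := hasDerivAt_zpow i (1 : ℝ) (by simp)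
    have a2 := (hasDerivAt_zpow ((i + j) * m') (1 : ℝ) (by simp)).sub_const 1
    have := a1.mul a2
    simp at this
    simp
    exact this
  have d2 : HasDerivAt (fun l : ℝ => (m : ℝ) * (l ^ (i + j) - 1))
      ((m * (i + j) : ℤ) : ℝ) 1 := by
    have a2 := ((hasDerivAt_zpow (i + j) (1 : ℝ) (by simp)).sub_const 1).const_mul (m : ℝ)
    simpa using a2
  have heq : (fun l : ℝ => l ^ i * (l ^ ((i + j) * m') - 1)) =ᶠ[nhds 1]
      (fun l : ℝ => (m : ℝ) * (l ^ (i + j) - 1)) := by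
    filter_upwards [lt_mem_nhds (zero_lt_one (α := ℝ))] with l hl using h1 l hl
  have := (d2.congr_of_eventuallyEq heq).unique d1
  have h2 : m * (i + j) = (i + j) * m' := by exact_mod_cast this
  rw [mul_comm m] at h2
  exact (mul_left_cancel₀ hij h2).symm

theorem convex_contra (k m n : ℤ) (hk : k ≠ 0) (hm : m ≠ 0) (hn : n ≠ 0) (hmn : m ≠ n) (c d : ℝ)
    (hc : c ≠ 0) (h1 : c * ((2 : ℝ) ^ (k * m) - 1) = m * d)
    (h2 : c * ((2 : ℝ) ^ (k * n) - 1) = n * d) : False := by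
  have hL : Real.log 2 ≠ 0 := (Real.log_pos (by norm_num)).ne'
  have hk' : (k : ℝ) ≠ 0 := by exact_mod_cast hk
  have hs : ∀ p : ℤ, p ≠ 0 → c * ((2 : ℝ) ^ (k * p) - 1) = p * d →
      (Real.exp (k * p * Real.log 2) - Real.exp 0) / (k * p * Real.log 2 - 0)
        = d / (c * k * Real.log 2) := by
    intro p hp h
    have hp' : (p : ℝ) ≠ 0 := by exact_mod_cast hp
    have : Real.exp (k * p * Real.log 2) = (2 : ℝ) ^ (k * p) := by
      rw [← Real.rpow_intCast, Real.rpow_def_of_pos (by norm_num)]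
      push_cast
      ring_nf
    rw [this, Real.exp_zero, sub_zero, div_eq_div_iff (by positivity) (by positivity)]
    linear_combination (k * Real.log 2) * h
  have hne : ∀ p : ℤ, p ≠ 0 → (k * p * Real.log 2 : ℝ) ≠ 0 := by
    intro p hp
    have hp' : (p : ℝ) ≠ 0 := by exact_mod_cast hp
    positivity
  have hmn' : (k * m * Real.log 2 : ℝ) ≠ k * n * Real.log 2 := by
    intro h
    have h3 := mul_left_cancel₀ hk' (mul_right_cancel₀ hL h)
    exact hmn (by exact_mod_cast h3)
  rcases lt_or_gt_of_ne hmn' with h | h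
  · have := strictConvexOn_exp.secant_strict_mono (Set.mem_univ 0) (Set.mem_univ _)
      (Set.mem_univ _) (hne m hm) (hne n hn) h
    rw [hs m hm h1, hs n hn h2] at this
    exact lt_irrefl _ this
  · have := strictConvexOn_exp.secant_strict_mono (Set.mem_univ 0) (Set.mem_univ _)
      (Set.mem_univ _) (hne n hn) (hne m hm) h
    rw [hs m hm h1, hs n hn h2] at this
    exact lt_irrefl _ this

theorem main_step {x t : F2} (h : IsBasis x t) (i j m m' n n' : ℤ) (hm : m ≠ 0) (hn : n ≠ 0)
    (hmn : m ≠ n)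
    (h1 : t ^ m * x * (t ^ m)⁻¹ =
      (x ^ i * t * x ^ j) ^ m' * x * ((x ^ i * t * x ^ j) ^ m')⁻¹)
    (h2 : t ^ n * x * (t ^ n)⁻¹ =
      (x ^ i * t * x ^ j) ^ n' * x * ((x ^ i * t * x ^ j) ^ n')⁻¹) :
    x ^ i * t * x ^ j = t := by
  by_cases hij : i + j = 0
  · have a := (fixed_pt h i j m m' h1 2 (by norm_num)).2 (by norm_num) hij
    have b := (fixed_pt h i j m m' h1 4 (by norm_num)).2 (by norm_num) hij
    have hm' : (m' : ℝ) ≠ 0 := by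
      intro h0
      rw [h0, mul_zero] at a
      exact hm (by exact_mod_cast a.symm)
    have e : (4 : ℝ) ^ i = 2 ^ i := mul_right_cancel₀ hm' (b.trans a.symm)
    have e2 : (2 : ℝ) ^ i = 1 := by
      have h4 : (4 : ℝ) = 2 * 2 := by norm_num
      rw [h4, mul_zpow] at e
      have h2 : (2 : ℝ) ^ i ≠ 0 := by positivity
      exact mul_left_cancel₀ h2 (by rw [e, mul_one])
    have hi : i = 0 := by
      rwa [zpow_eq_one_iff_right₀ (by norm_num) (by norm_num)] at e2
    have hj : j = 0 := by omega
    simp [hi, hj]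
  · exfalso
    have e1 := exp_eq h i j m m' hij h1
    have e2 := exp_eq h i j n n' hij h2
    subst e1 e2
    have a := (fixed_pt h i j _ _ h1 2 (by norm_num)).1
    have b := (fixed_pt h i j _ _ h2 2 (by norm_num)).1
    exact convex_contra (i + j) _ _ hij hm hn hmn _ _ (by positivity) a b

theorem conjugates_common_neighbors_subsingleton (x y z : F2)
    (hx : Primitive x) (hy : Primitive y) (hz : Primitive z)
    (hxy : zpowers x ≠ zpowers y) (hyz : zpowers y ≠ zpowers z)
    (hxz : zpowers x ≠ zpowers z)
    (cxy : IsConj x y) (cyz : IsConj y z) (cxz : IsConj x z) :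
    Set.Subsingleton
      {T : Subgroup F2 | ∃ t : F2, T = zpowers t ∧
        IsBasis x t ∧ IsBasis y t ∧ IsBasis z t} := by
  rintro _ ⟨t, rfl, hxt, hyt, hzt⟩ _ ⟨u, rfl, hxu, hyu, hzu⟩
  obtain ⟨m, hm⟩ := conj_form hxt hyt cxy
  obtain ⟨n, hn⟩ := conj_form hxt hzt cxz
  obtain ⟨m', hm'⟩ := conj_form hxu hyu cxy
  obtain ⟨n', hn'⟩ := conj_form hxu hzu cxz
  have m0 : m ≠ 0 := by
    rintro rfl; apply hxy; rw [hm]; simp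
  have n0 : n ≠ 0 := by
    rintro rfl; apply hxz; rw [hn]; simp
  have mn : m ≠ n := by
    rintro rfl; apply hyz; rw [hn, hm]
  obtain ⟨i, j, h | h⟩ := key x t u hxt hxu
  · rw [hm, h] at hm'
    rw [hn, h] at hn'
    rw [h, main_step hxt i j m m' n n' m0 n0 mn hm' hn']
  · have hu : u⁻¹ = x ^ (-j) * t * x ^ (-i) := by rw [h]; group
    have hu' : ∀ k : ℤ, u ^ k = (x ^ (-j) * t * x ^ (-i)) ^ (-k) := by
      intro k; rw [← hu, inv_zpow', neg_neg]
    rw [hm, hu'] at hm'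
    rw [hn, hu'] at hn'
    rw [← zpowers_inv (g := u), hu, main_step hxt _ _ m _ n _ m0 n0 mn hm' hn']
end

section
/- Let F_2 = ⟨a, b⟩ and let g ∈ F_2 have reduced form g = a^{k_1} b^{m_1} ⋯ a^{k_s} b^{m_s} with all k_i nonzero. Then there is a unique reduced path of length k = Σ|k_i| from ⟨b^g⟩ to ⟨b⟩ in the graph on conjugates of ⟨b⟩ with edge relation C (1-conjugacy). Consequently, the conjugacy class of a vertex of AF_2 with the edge relation C is a tree. -/
open Subgroup

/-- 1-conjugacy on vertices of `AF₂` (cyclic subgroups). -/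
def CRelS (S T : Subgroup F2) : Prop :=
  ∃ x z : F2, S = zpowers x ∧ IsBasis x z ∧ T = zpowers (z⁻¹ * x * z)

/-- The `a`-length of `g`: the number of occurrences of `a^{±1}` in the reduced
word of `g`, i.e. `Σ |k_i|`. -/
def aLength (g : F2) : ℕ :=
  (FreeGroup.toWord g).countP (fun l => decide (l.1 = (0 : Fin 2)))

/-- A reduced `C`-path: consecutive vertices are `C`-related and there is no
backtracking. -/
def IsReducedCPath (p : List (Subgroup F2)) : Prop :=
  List.Chain' CRelS p ∧ ∀ i : ℕ, i + 2 < p.length → p[i]? ≠ p[i + 2]?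


open FreeGroup (mk toWord invRev)

def lt (l : Fin 2 × Bool) : F2 := FreeGroup.mk [l]

theorem lt_inv (i : Fin 2) (e : Bool) : (lt (i, e))⁻¹ = lt (i, !e) := by
  simp [lt, FreeGroup.inv_mk, FreeGroup.invRev]

theorem lt_cancel (i : Fin 2) (e : Bool) (g : F2) : lt (i, !e) * (lt (i, e) * g) = g := by
  rw [← lt_inv]; group

theorem lt_cancel' (i : Fin 2) (e : Bool) (g : F2) : lt (i, e) * (lt (i, !e) * g) = g := by
  rw [← lt_inv]; group

theorem gb_eq : gb = lt (1, true) := rfl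
theorem ga_eq : ga = lt (0, true) := rfl
theorem gb_inv : gb⁻¹ = lt (1, false) := by rw [gb_eq, lt_inv]; rfl

theorem toWord_lt (l : Fin 2 × Bool) : toWord (lt l) = [l] := by
  simp [lt]

theorem toWord_lt_mul (i : Fin 2) (e : Bool) (g : F2) :
    (∃ t, toWord g = (i, !e) :: t ∧ toWord (lt (i, e) * g) = t) ∨
    ((toWord g).head? ≠ some (i, !e) ∧ toWord (lt (i, e) * g) = (i, e) :: toWord g) := by
  rw [FreeGroup.toWord_mul, toWord_lt, List.singleton_append, FreeGroup.reduce.cons,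
    FreeGroup.reduce_toWord]
  rcases h : toWord g with _ | ⟨⟨j, f⟩, t⟩
  · right; simp
  · by_cases hc : i = j ∧ e = !f
    · left; refine ⟨t, ?_, ?_⟩
      · obtain ⟨rfl, rfl⟩ := hc; simp
      · simp [hc]
    · right
      refine ⟨?_, ?_⟩
      · simp only [List.head?_cons, ne_eq, Option.some.injEq, Prod.mk.injEq]
        rintro ⟨rfl, hf⟩; apply hc; simp [hf]
      · simp only [if_neg hc]

theorem aLength_inv (g : F2) : aLength g⁻¹ = aLength g := by
  unfold aLength
  rw [FreeGroup.toWord_inv, FreeGroup.invRev, List.countP_reverse, List.countP_map]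
  rfl

theorem aLength_b1 (e : Bool) (g : F2) : aLength (lt (1, e) * g) = aLength g := by
  unfold aLength
  rcases toWord_lt_mul 1 e g with ⟨t, h1, h2⟩ | ⟨h1, h2⟩
  · rw [h1, h2]; simp
  · rw [h2]; simp

theorem aLength_b (k : ℤ) (g : F2) : aLength (gb ^ k * g) = aLength g := by
  induction k using Int.induction_on generalizing g with
  | zero => simp
  | succ n ih => rw [zpow_add, mul_assoc, ih, zpow_one, gb_eq, aLength_b1]
  | pred n ih => rw [zpow_sub, mul_assoc, ih, zpow_one, gb_inv, aLength_b1]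

theorem aLength_b_right (k : ℤ) (g : F2) : aLength (g * gb ^ k) = aLength g := by
  rw [← aLength_inv, mul_inv_rev, ← zpow_neg, aLength_b, aLength_inv]

theorem aLength_a (e : Bool) (g : F2) :
    ((toWord g).head? = some (0, !e) ∧ aLength (lt (0, e) * g) + 1 = aLength g) ∨
    ((toWord g).head? ≠ some (0, !e) ∧ aLength (lt (0, e) * g) = aLength g + 1) := by
  unfold aLength
  rcases toWord_lt_mul 0 e g with ⟨t, h1, h2⟩ | ⟨h1, h2⟩
  · left; rw [h1, h2]; simp
  · right; rw [h2]; exact ⟨h1, by simp⟩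

theorem head_bpow (e : Bool) (n : ℕ) (h : F2) (hh : (toWord h).head? ≠ some (1, !e)) :
    (toWord (lt (1, e) ^ (n + 1) * h)).head? = some (1, e) := by
  induction n with
  | zero =>
    rcases toWord_lt_mul 1 e h with ⟨t, h1, h2⟩ | ⟨h1, h2⟩
    · simp [h1] at hh
    · simp [h2]
  | succ n ih =>
    rw [pow_succ', mul_assoc]
    rcases toWord_lt_mul 1 e (lt (1, e) ^ (n + 1) * h) with ⟨t, h1, h2⟩ | ⟨h1, h2⟩
    · rw [h1] at ih; simp at ih
    · simp [h2]

theorem zpow_gb_eq (k : ℤ) (hk : k ≠ 0) : ∃ e n, gb ^ k = lt (1, e) ^ (n + 1) := by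
  rcases lt_or_gt_of_ne hk with h | h
  · obtain ⟨n, hn⟩ : ∃ n : ℕ, k = -((n + 1 : ℕ) : ℤ) := ⟨(-k - 1).toNat, by omega⟩
    refine ⟨false, n, ?_⟩
    rw [hn, zpow_neg, zpow_natCast, ← inv_pow, gb_inv]
  · obtain ⟨n, hn⟩ : ∃ n : ℕ, k = ((n + 1 : ℕ) : ℤ) := ⟨(k - 1).toNat, by omega⟩
    refine ⟨true, n, ?_⟩
    rw [hn, zpow_natCast, gb_eq]

/-- If `h` starts with an `a`-letter (or is trivial), then `b^k h` starts with a `b`-letter. -/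
theorem head_zpow (k : ℤ) (hk : k ≠ 0) (h : F2)
    (hh : ∀ e, (toWord h).head? ≠ some (1, e)) :
    ∃ e, (toWord (gb ^ k * h)).head? = some (1, e) := by
  obtain ⟨e, n, hn⟩ := zpow_gb_eq k hk
  exact ⟨e, by rw [hn]; exact head_bpow e n h (hh _)⟩

theorem descent_unique (g : F2) (d d' : Bool) (k k' : ℤ)
    (h : aLength (lt (0, d) * (gb ^ k * g)) < aLength g)
    (h' : aLength (lt (0, d') * (gb ^ k' * g)) < aLength g) : d = d' ∧ k = k' := by
  have key : ∀ (d : Bool) (k : ℤ), aLength (lt (0, d) * (gb ^ k * g)) < aLength g →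
      (toWord (gb ^ k * g)).head? = some (0, !d) := by
    intro d k h
    rcases aLength_a d (gb ^ k * g) with ⟨h1, h2⟩ | ⟨h1, h2⟩
    · exact h1
    · rw [aLength_b] at h2; omega
  have e1 := key _ _ h
  have e2 := key _ _ h'
  have hk : k = k' := by
    by_contra hne
    obtain ⟨e, he⟩ := head_zpow (k' - k) (by omega) (gb ^ k * g) (by rw [e1]; simp)
    rw [← mul_assoc, ← zpow_add, sub_add_cancel, e2] at he
    simp at he
  subst hk
  rw [e1] at e2
  simpa using e2

/-- Stripping: every double coset has a representative without outer `b`-letters. -/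
theorem strip_left (g : F2) : ∃ k : ℤ, ∀ e, (toWord (gb ^ k * g)).head? ≠ some (1, e) := by
  induction hn : (toWord g).length generalizing g with
  | zero => exact ⟨0, by simp [List.length_eq_zero_iff.1 hn]⟩
  | succ n ih =>
    by_cases hb : ∃ e, (toWord g).head? = some (1, e)
    · obtain ⟨e, he⟩ := hb
      rcases toWord_lt_mul 1 (!e) g with ⟨t, h1, h2⟩ | ⟨h1, h2⟩
      · obtain ⟨k, hk⟩ := ih (lt (1, !e) * g) (by rw [h2]; rw [h1] at hn; simpa using hn)
        obtain ⟨j, hj⟩ : ∃ j : ℤ, lt (1, !e) = gb ^ j := by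
          cases e
          · exact ⟨1, by simp [gb_eq]⟩
          · exact ⟨-1, by simp [gb_inv]⟩
        refine ⟨k + j, ?_⟩
        rw [zpow_add, mul_assoc, ← hj]; exact hk
      · simp [he] at h1
    · exact ⟨0, by simpa using hb⟩

theorem head_of_pos (g : F2) (h0 : aLength g ≠ 0) (hh : ∀ e, (toWord g).head? ≠ some (1, e)) :
    ∃ e, (toWord g).head? = some (0, e) := by
  rcases h : toWord g with _ | ⟨⟨i, e⟩, t⟩
  · simp [aLength, h] at h0
  · fin_cases i
    · exact ⟨e, rfl⟩
    · exact absurd (by rw [h]; rfl) (hh e)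

theorem exists_descent (g : F2) (h0 : aLength g ≠ 0) :
    ∃ (d : Bool) (k : ℤ), aLength (lt (0, d) * (gb ^ k * g)) + 1 = aLength g := by
  obtain ⟨k, hk⟩ := strip_left g
  obtain ⟨e, he⟩ := head_of_pos _ (by rwa [aLength_b]) hk
  refine ⟨!e, k, ?_⟩
  rcases aLength_a (!e) (gb ^ k * g) with ⟨h1, h2⟩ | ⟨h1, h2⟩
  · rw [h2, aLength_b]
  · simp [he] at h1

theorem aLength_zero (g : F2) (h0 : aLength g = 0) : ∃ k : ℤ, g = gb ^ k := by
  obtain ⟨k, hk⟩ := strip_left g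
  have : toWord (gb ^ k * g) = [] := by
    have h1 : aLength (gb ^ k * g) = 0 := by rwa [aLength_b]
    rcases h : toWord (gb ^ k * g) with _ | ⟨⟨i, e⟩, t⟩
    · rfl
    · fin_cases i
      · simp [aLength, h] at h1
      · exact absurd (by rw [h]; rfl) (hk e)
  rw [FreeGroup.toWord_eq_nil_iff] at this
  exact ⟨-k, by rw [zpow_neg]; exact eq_inv_of_mul_eq_one_right this⟩

theorem gb_not_finite (g : F2) : ¬ IsOfFinOrder (g⁻¹ * gb * g) := by
  intro h
  have h1 : g⁻¹ * gb * g = 1 := by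
    by_contra hne
    exact not_isOfFinOrder_of_isMulTorsionFree hne h
  have h2 : gb = 1 := by
    have : gb = g * (g⁻¹ * gb * g) * g⁻¹ := by group
    rw [this, h1]; group
  exact FreeGroup.of_ne_one _ h2

/-- The normaliser of `⟨b⟩` is `⟨b⟩`. -/
theorem normalizer_b (w : F2) (j : ℤ) (h : gb * w = w * gb ^ j) : ∃ k : ℤ, w = gb ^ k := by
  apply aLength_zero
  by_contra h0
  obtain ⟨k, hk⟩ := strip_left w
  obtain ⟨e, he⟩ := head_of_pos _ (by rwa [aLength_b]) hk
  set v := gb ^ k * w with hv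
  have hvv : gb * v = v * gb ^ j := by
    rw [hv, mul_assoc, ← h, ← mul_assoc, ← mul_assoc, ← zpow_one_add, ← zpow_add_one, add_comm]
  obtain ⟨f, hf⟩ := head_zpow 1 one_ne_zero v hk
  rw [zpow_one] at hf
  have c1 : aLength (lt (0, !e) * (gb * v)) = aLength v + 1 := by
    rcases aLength_a (!e) (gb * v) with ⟨h1, h2⟩ | ⟨h1, h2⟩
    · simp [hf] at h1
    · rw [h2]; congr 1; simpa using aLength_b 1 v
  have c2 : aLength (lt (0, !e) * (gb * v)) + 1 = aLength v := by
    rw [hvv, ← mul_assoc, aLength_b_right]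
    rcases aLength_a (!e) v with ⟨h1, h2⟩ | ⟨h1, h2⟩
    · exact h2
    · simp [he] at h1
  omega

def Vx (g : F2) : Subgroup F2 := zpowers (g⁻¹ * gb * g)

theorem Vx_b (k : ℤ) (g : F2) : Vx (gb ^ k * g) = Vx g := by
  unfold Vx; congr 1
  have : gb * gb ^ k = gb ^ k * gb := by rw [← zpow_one_add, ← zpow_add_one, add_comm]
  calc (gb ^ k * g)⁻¹ * gb * (gb ^ k * g) = g⁻¹ * (gb ^ k)⁻¹ * (gb * gb ^ k) * g := by group
    _ = _ := by rw [this]; group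

theorem gen_eq (x g : F2) (h : zpowers (g⁻¹ * gb * g) = zpowers x) :
    x = g⁻¹ * gb * g ∨ x = g⁻¹ * gb⁻¹ * g := by
  rcases (Subgroup.zpowers_eq_zpowers_iff (gb_not_finite g)).1 h with h | h
  · left; rw [← h]
  · right; rw [← inv_inv x, ← inv_inv (g⁻¹ * gb⁻¹ * g)]; congr 1
    rw [← h]; group

theorem Vx_eq (g h : F2) (e : Vx g = Vx h) : ∃ k : ℤ, h = gb ^ k * g := by
  have : ∃ j : ℤ, h⁻¹ * gb * h = g⁻¹ * gb ^ j * g := by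
    rcases gen_eq _ _ e with e | e
    · exact ⟨1, by simpa using e⟩
    · exact ⟨-1, by simpa using e⟩
  obtain ⟨j, hj⟩ := this
  obtain ⟨k, hk⟩ := normalizer_b (h * g⁻¹) j (by
    calc gb * (h * g⁻¹) = h * (h⁻¹ * gb * h) * g⁻¹ := by group
      _ = _ := by rw [hj]; group)
  exact ⟨k, by rw [← hk]; group⟩

theorem head?_inv (u : F2) (i : Fin 2) (e : Bool) (h : (toWord u).getLast? = some (i, e)) :
    (toWord u⁻¹).head? = some (i, !e) := by
  rw [FreeGroup.toWord_inv, FreeGroup.invRev, List.head?_reverse, List.getLast?_map, h]; rfl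

theorem getLast?_inv (u : F2) (i : Fin 2) (e : Bool) (h : (toWord u).head? = some (i, e)) :
    (toWord u⁻¹).getLast? = some (i, !e) := by
  rw [FreeGroup.toWord_inv, FreeGroup.invRev, List.getLast?_reverse, List.head?_map, h]; rfl

theorem toWord_mul_of_reduced (x y : F2) (h : FreeGroup.IsReduced (toWord x ++ toWord y)) :
    toWord (x * y) = toWord x ++ toWord y := by
  rw [FreeGroup.toWord_mul, h.reduce_eq]

/-- letterwise substitution `a ↦ w`, `b ↦ b` -/
def sub (w : List (Fin 2 × Bool)) (l : Fin 2 × Bool) : List (Fin 2 × Bool) :=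
  if l.1 = 0 then (if l.2 then w else invRev w) else [l]

theorem lift_eq_sub (u : F2) (L : List (Fin 2 × Bool)) :
    FreeGroup.lift ![u, gb] (mk L) = mk ((L.map (sub (toWord u))).flatten) := by
  induction L with
  | nil => simp [← FreeGroup.one_eq_mk]
  | cons l L ih =>
    have h1 : (mk (l :: L) : F2) = mk [l] * mk L := by rw [FreeGroup.mul_mk]; rfl
    rw [h1, map_mul, ih, List.map_cons, List.flatten_cons, ← FreeGroup.mul_mk]
    congr 1
    obtain ⟨i, e⟩ := l
    fin_cases i <;> cases e <;>
      simp [sub, FreeGroup.mk_toWord, ← FreeGroup.inv_mk]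
    · exact gb_inv
    · rfl

theorem case_one (u : F2) (e : Bool) (hh : (toWord u).head? = some (0, e))
    (hl : (toWord u).getLast? = some (0, e)) (hs : ∃ t, FreeGroup.lift ![u, gb] t = ga) :
    u = lt (0, e) := by
  obtain ⟨t, ht⟩ := hs
  have hne : toWord u ≠ [] := by rintro h; simp [h] at hh
  have hsub : ∀ l, ∃ f, (sub (toWord u) l).head? = some (l.1, f) ∧
      (sub (toWord u) l).getLast? = some (l.1, f) ∧ (f = if l.1 = 0 then (l.2 == e) else l.2) := by
    rintro ⟨i, f⟩
    fin_cases i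
    · cases f
      · refine ⟨!e, ?_, ?_, ?_⟩
        · simpa [sub, FreeGroup.toWord_inv] using head?_inv u 0 e hl
        · simpa [sub, FreeGroup.toWord_inv] using getLast?_inv u 0 e hh
        · cases e <;> rfl
      · refine ⟨e, by simpa [sub] using hh, by simpa [sub] using hl, ?_⟩
        cases e <;> rfl
    · exact ⟨f, by simp [sub], by simp [sub], by simp⟩
  have hred : FreeGroup.IsReduced (((toWord t).map (sub (toWord u))).flatten) := by
    unfold FreeGroup.IsReduced
    rw [List.isChain_flatten]
    · constructor
      · intro l hl
        obtain ⟨⟨i, f⟩, -, rfl⟩ := List.mem_map.1 hl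
        fin_cases i <;> cases f
        · have := FreeGroup.isReduced_toWord (x := u⁻¹)
          rw [FreeGroup.toWord_inv] at this
          simpa [sub, FreeGroup.IsReduced] using this
        · simpa [sub, FreeGroup.IsReduced] using FreeGroup.isReduced_toWord (x := u)
        · simp [sub]
        · simp [sub]
      · rw [List.isChain_map]
        refine (FreeGroup.isReduced_toWord (x := t)).imp ?_
        intro l l' hll x hx y hy
        obtain ⟨f, -, h2, h3⟩ := hsub l
        obtain ⟨f', h1, -, h3'⟩ := hsub l'
        rw [h2] at hx; rw [h1] at hy
        simp only [Option.mem_def, Option.some.injEq] at hx hy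
        subst hx hy
        intro h
        simp only at h ⊢
        rw [h3, h3', h, hll h]
    · intro h
      obtain ⟨l, -, hl⟩ := List.mem_map.1 h
      obtain ⟨f, h1, -⟩ := hsub l
      simp [hl] at h1
  have hw : ((toWord t).map (sub (toWord u))).flatten = [(0, true)] := by
    have h2 := lift_eq_sub u (toWord t)
    rw [FreeGroup.mk_toWord, ht] at h2
    have h3 := congrArg toWord h2
    rw [FreeGroup.toWord_mk, hred.reduce_eq, ga_eq, toWord_lt] at h3
    exact h3.symm
  rcases h : toWord t with _ | ⟨⟨i, f⟩, L⟩
  · simp [h] at hw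
  · rw [h, List.map_cons, List.flatten_cons] at hw
    obtain ⟨g, h1, -⟩ := hsub (i, f)
    rcases hs : sub (toWord u) (i, f) with _ | ⟨y, S⟩
    · simp [hs] at h1
    · rw [hs] at hw h1
      simp at hw h1
      have hS : S = [] := hw.2.1
      have hlen : (toWord u).length = 1 := by
        have hi : i = 0 := by
          have := h1.symm.trans hw.1
          simpa using congrArg Prod.fst this
        subst hi
        have := congrArg List.length hs
        cases f <;> simpa [sub, hS] using this
      obtain ⟨y, hy⟩ := List.length_eq_one_iff.1 hlen
      rw [hy] at hh
      simp at hh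
      rw [← FreeGroup.toWord_inj, hy, hh, toWord_lt]

inductive PP (u : F2) (e : Bool) : Bool → F2 → Prop
  | base (k : ℤ) : PP u e false (gb ^ k * lt (0, !e))
  | bstep (k : ℤ) (x : F2) : k ≠ 0 → PP u e true x → PP u e false (gb ^ k * x)
  | ustep (j : ℤ) (y : F2) : j ≠ 0 → PP u e false y → PP u e true (u ^ j * y)

theorem pow_ends (u : F2) (e : Bool) (hh : (toWord u).head? = some (0, e))
    (hl : (toWord u).getLast? = some (0, !e)) (n : ℕ) :
    (toWord (u ^ (n + 1))).head? = some (0, e) ∧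
    (toWord (u ^ (n + 1))).getLast? = some (0, !e) := by
  rw [FreeGroup.toWord_pow, FreeGroup.reduceCyclically.reduce_flatten_replicate_succ
    FreeGroup.isReduced_toWord]
  obtain ⟨c, hc⟩ : ∃ c, FreeGroup.reduceCyclically.conjugator (toWord u) = (0, e) :: c := by
    revert hh hl
    induction toWord u using List.bidirectionalRec with
    | nil => simp
    | singleton a => simp; rintro rfl; simp
    | cons_append a l b _ =>
      rw [FreeGroup.reduceCyclically.conjugator.cons_append]
      intro h1 h2
      rw [← List.cons_append, List.getLast?_concat] at h2
      rw [List.head?_cons] at h1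
      simp only [Option.some.injEq] at h1 h2
      subst h1 h2
      simp
  rw [hc]
  constructor
  · simp
  · rw [FreeGroup.invRev_cons, ← List.append_assoc]
    exact List.getLast?_concat

theorem zpow_ends (u : F2) (e : Bool) (hh : (toWord u).head? = some (0, e))
    (hl : (toWord u).getLast? = some (0, !e)) (k : ℤ) (hk : k ≠ 0) :
    (toWord (u ^ k)).head? = some (0, e) ∧ (toWord (u ^ k)).getLast? = some (0, !e) := by
  rcases lt_or_gt_of_ne hk with h | h
  · obtain ⟨n, hn⟩ : ∃ n : ℕ, k = -((n + 1 : ℕ) : ℤ) := ⟨(-k - 1).toNat, by omega⟩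
    rw [hn, zpow_neg, zpow_natCast]
    obtain ⟨h1, h2⟩ := pow_ends u e hh hl n
    exact ⟨by simpa using head?_inv _ _ _ h2, getLast?_inv _ _ _ h1⟩
  · obtain ⟨n, hn⟩ : ∃ n : ℕ, k = ((n + 1 : ℕ) : ℤ) := ⟨(k - 1).toNat, by omega⟩
    rw [hn, zpow_natCast]
    exact pow_ends u e hh hl n

theorem PP_head (u : F2) (e : Bool) (hh : (toWord u).head? = some (0, e))
    (hl : (toWord u).getLast? = some (0, !e)) (s : Bool) (g : F2) (h : PP u e s g) :
    (s = true → (toWord g).head? = some (0, e)) ∧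
    (s = false → (toWord g).head? ≠ some (0, e) ∧ toWord g ≠ []) := by
  induction h with
  | base k =>
    simp only [Bool.false_eq_true, false_imp_iff, true_and, forall_const]
    by_cases hk : k = 0
    · subst hk; simp [toWord_lt]
    · obtain ⟨f, hf⟩ := head_zpow k hk (lt (0, !e)) (by simp [toWord_lt])
      refine ⟨by simp [hf], fun h => by simp [h] at hf⟩
  | bstep k x hk hx ih =>
    simp only [Bool.false_eq_true, false_imp_iff, true_and, forall_const]
    obtain ⟨f, hf⟩ := head_zpow k hk x (by rw [ih.1 rfl]; simp)
    refine ⟨by simp [hf], fun h => by simp [h] at hf⟩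
  | ustep j y hj hy ih =>
    simp only [Bool.true_eq_false, false_imp_iff, and_true, forall_const]
    obtain ⟨h1, h2⟩ := zpow_ends u e hh hl j hj
    rw [toWord_mul_of_reduced, List.head?_append, h1]
    · rfl
    · refine List.isChain_append.2 ⟨FreeGroup.isReduced_toWord, FreeGroup.isReduced_toWord, ?_⟩
      intro x hx z hz
      rw [h2] at hx
      simp only [Option.mem_def, Option.some.injEq] at hx
      subst hx
      obtain ⟨i, f⟩ := z
      intro h
      simp only at h
      subst h
      by_contra hne
      apply (ih.2 rfl).1
      rw [Option.mem_def.1 hz]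
      simp only at hne
      congr 2
      revert hne
      cases e <;> cases f <;> simp

theorem PP_b (u : F2) (e : Bool) (g : F2) (h : ∃ s, PP u e s g) (k : ℤ) :
    ∃ s, PP u e s (gb ^ k * g) := by
  by_cases hk : k = 0
  · subst hk; simpa using h
  obtain ⟨s, h⟩ := h
  cases h with
  | base j => exact ⟨_, by rw [← mul_assoc, ← zpow_add]; exact .base _⟩
  | bstep j x hj hx =>
    rw [← mul_assoc, ← zpow_add]
    by_cases h0 : k + j = 0
    · rw [h0]; exact ⟨_, by simpa using hx⟩
    · exact ⟨_, .bstep _ _ h0 hx⟩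
  | ustep j y hj hy => exact ⟨_, .bstep _ _ hk (.ustep _ _ hj hy)⟩

theorem PP_u (u : F2) (e : Bool) (g : F2) (h : ∃ s, PP u e s g) (k : ℤ) :
    ∃ s, PP u e s (u ^ k * g) := by
  by_cases hk : k = 0
  · subst hk; simpa using h
  obtain ⟨s, h⟩ := h
  cases h with
  | base j => exact ⟨_, .ustep _ _ hk (.base _)⟩
  | bstep j x hj hx => exact ⟨_, .ustep _ _ hk (.bstep _ _ hj hx)⟩
  | ustep j y hj hy =>
    rw [← mul_assoc, ← zpow_add]
    by_cases h0 : k + j = 0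
    · rw [h0]; exact ⟨_, by simpa using hy⟩
    · exact ⟨_, .ustep _ _ h0 hy⟩

theorem case_two (u : F2) (e : Bool) (hh : (toWord u).head? = some (0, e))
    (hl : (toWord u).getLast? = some (0, !e))
    (hs : ∃ t, FreeGroup.lift ![u, gb] t = lt (0, e)) : False := by
  obtain ⟨t, ht⟩ := hs
  have key : ∀ (t : F2) (g : F2), (∃ s, PP u e s g) →
      ∃ s, PP u e s (FreeGroup.lift ![u, gb] t * g) := by
    intro t
    induction t using FreeGroup.induction_on with
    | C1 => intro g h; simpa using h
    | of i =>
      intro g h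
      fin_cases i
      · simpa using PP_u u e g h 1
      · simpa using PP_b u e g h 1
    | inv_of i _ =>
      intro g h
      fin_cases i
      · simpa using PP_u u e g h (-1)
      · simpa using PP_b u e g h (-1)
    | mul x y hx hy =>
      intro g h
      rw [map_mul, mul_assoc]
      exact hx _ (hy _ h)
  obtain ⟨s, h⟩ := key t (lt (0, !e)) ⟨false, by simpa using PP.base (u := u) (e := e) 0⟩
  rw [ht, ← lt_inv, mul_inv_cancel] at h
  have := PP_head u e hh hl s 1 h
  cases s <;> simp at this

theorem shorten (u : F2) (e : Bool) (h : (toWord u).head? = some (1, e)) :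
    ∃ j : ℤ, (toWord (gb ^ j * u)).length < (toWord u).length := by
  obtain ⟨j, hj⟩ : ∃ j : ℤ, lt (1, !e) = gb ^ j := by
    cases e
    · exact ⟨1, by simp [gb_eq]⟩
    · exact ⟨-1, by simp [gb_inv]⟩
  refine ⟨j, ?_⟩
  rw [← hj]
  rcases toWord_lt_mul 1 (!e) u with ⟨t, h1, h2⟩ | ⟨h1, h2⟩
  · rw [h1, h2]; simp
  · simp [h] at h1

theorem length_inv (u : F2) : (toWord u⁻¹).length = (toWord u).length := by
  rw [FreeGroup.toWord_inv, FreeGroup.invRev_length]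

theorem basis_char (z : F2) (H : ∀ K : Subgroup F2, gb ∈ K → z ∈ K → ∀ y, y ∈ K) :
    ∃ (m n : ℤ) (d : Bool), z = gb ^ m * lt (0, d) * gb ^ n := by
  let f : ℤ × ℤ → ℕ := fun p => (toWord (gb ^ p.1 * z * gb ^ p.2)).length
  obtain ⟨⟨m, n⟩, hp⟩ : ∃ p, ∀ q, f p ≤ f q := ⟨Function.argmin f, fun q => Function.argmin_le f q⟩
  set u := gb ^ m * z * gb ^ n with hu
  have hz : z = gb ^ (-m) * u * gb ^ (-n) := by rw [hu]; group
  have hsurj : ∀ y, ∃ t, FreeGroup.lift ![u, gb] t = y := by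
    have hb : gb ∈ (FreeGroup.lift ![u, gb] : F2 →* F2).range := ⟨FreeGroup.of 1, by simp⟩
    have hu' : u ∈ (FreeGroup.lift ![u, gb] : F2 →* F2).range := ⟨FreeGroup.of 0, by simp⟩
    refine H _ hb ?_
    rw [hz]
    exact mul_mem (mul_mem (zpow_mem hb _) hu') (zpow_mem hb _)
  have hpos : aLength u ≠ 0 := by
    intro h0
    obtain ⟨k, hk⟩ := aLength_zero u h0
    have := H (zpowers gb) (mem_zpowers gb) (by
      rw [hz, hk]; exact mul_mem (mul_mem (zpow_mem (mem_zpowers _) _)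
        (zpow_mem (mem_zpowers _) _)) (zpow_mem (mem_zpowers _) _)) ga
    obtain ⟨j, hj⟩ := mem_zpowers_iff.1 this
    have h1 := congrArg aLength hj
    have h2 := aLength_b j 1
    rw [mul_one] at h2
    rw [h2, ga_eq] at h1
    simp [aLength, toWord_lt] at h1
  have hhead : ∀ e, (toWord u).head? ≠ some (1, e) := by
    intro e he
    obtain ⟨j, hj⟩ := shorten u e he
    have := hp (j + m, n)
    change (toWord u).length ≤ (toWord (gb ^ (j + m) * z * gb ^ n)).length at this
    rw [show gb ^ (j + m) * z * gb ^ n = gb ^ j * u by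
      rw [hu, zpow_add]; simp only [mul_assoc]] at this
    omega
  have hlast : ∀ e, (toWord u⁻¹).head? ≠ some (1, e) := by
    intro e he
    obtain ⟨j, hj⟩ := shorten u⁻¹ e he
    have := hp (m, n + -j)
    simp only [f] at this
    rw [zpow_add, ← mul_assoc, ← hu, ← length_inv (u * _), mul_inv_rev, ← zpow_neg, neg_neg] at this
    rw [length_inv] at hj
    omega
  obtain ⟨e, he⟩ := head_of_pos u hpos hhead
  obtain ⟨e', he'⟩ := head_of_pos u⁻¹ (by rwa [aLength_inv]) hlast
  have hl := getLast?_inv _ _ _ he'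
  rw [inv_inv] at hl
  have : (!e') = e := by
    by_contra hne
    have h2 : (!e') = !e := by revert hne; cases e <;> cases e' <;> simp
    rw [h2] at hl
    exact case_two u e he hl (hsurj _)
  rw [this] at hl
  have hfin := case_one u e he hl (hsurj _)
  exact ⟨-m, -n, e, by rw [← hfin]; exact hz⟩

theorem C_out (g : F2) (T : Subgroup F2) (h : CRelS (Vx g) T) :
    ∃ (d : Bool) (k : ℤ), T = Vx (lt (0, d) * (gb ^ k * g)) := by
  obtain ⟨x, z, hS, hB, rfl⟩ := h
  have hx := gen_eq x g hS
  obtain ⟨m, n, d, hz⟩ := basis_char (g * z * g⁻¹) (by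
    intro K hb hz y
    have hle : (FreeGroup.lift ![x, z] : F2 →* F2).range ≤
        K.comap (MulAut.conj g).toMonoidHom := by
      apply FreeGroup.range_lift_le
      rintro _ ⟨i, rfl⟩
      fin_cases i
      · change g * x * g⁻¹ ∈ K
        rcases hx with rfl | rfl
        · convert hb using 1; group
        · convert inv_mem hb using 1; group
      · exact hz
    obtain ⟨t, ht⟩ := hB.2 (g⁻¹ * y * g)
    have h1 : g * (g⁻¹ * y * g) * g⁻¹ ∈ K := hle ⟨t, ht⟩
    convert h1 using 1; group)
  refine ⟨d, n, ?_⟩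
  have hz' : z = g⁻¹ * gb ^ m * (lt (0, d) * (gb ^ n * g)) := by
    calc z = g⁻¹ * (g * z * g⁻¹) * g := by group
      _ = _ := by rw [hz]; group
  unfold Vx
  generalize lt (0, d) * (gb ^ n * g) = w at hz'
  subst hz'
  rcases hx with rfl | rfl
  · congr 1; group
  · rw [← zpowers_inv]; congr 1; group

theorem basis_ba (d : Bool) : IsBasis gb (lt (0, d)) := by
  let τ : F2 →* F2 := FreeGroup.lift ![lt (1, d), FreeGroup.of 0]
  have hlt : ∀ (i : Fin 2) (φ : F2 →* F2), φ (lt (i, d)) =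
      if d then φ (FreeGroup.of i) else (φ (FreeGroup.of i))⁻¹ := by
    intro i φ
    cases d
    · rw [← Bool.not_true, ← lt_inv, map_inv]; rfl
    · rfl
  have e1 : τ.comp (FreeGroup.lift ![gb, lt (0, d)]) = MonoidHom.id F2 := by
    ext i
    fin_cases i
    · simp [τ, gb]
    · simp [hlt]
      cases d
      · simp [τ]; rw [← Bool.not_true, ← lt_inv, inv_inv]; rfl
      · simp [τ]; rfl
  have e2 : (FreeGroup.lift ![gb, lt (0, d)]).comp τ = MonoidHom.id F2 := by
    ext i
    fin_cases i
    · simp [τ, hlt]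
      cases d
      · simp; rw [← Bool.not_true, ← lt_inv, inv_inv]; rfl
      · simp; rfl
    · simp [τ, gb]
  exact Function.bijective_iff_has_inverse.2
    ⟨τ, fun x => DFunLike.congr_fun e1 x, fun x => DFunLike.congr_fun e2 x⟩

theorem C_in (g : F2) (d : Bool) : CRelS (Vx g) (Vx (lt (0, d) * g)) := by
  refine ⟨g⁻¹ * gb * g, g⁻¹ * lt (0, d) * g, rfl, ?_, ?_⟩
  · have : (FreeGroup.lift ![g⁻¹ * gb * g, g⁻¹ * lt (0, d) * g] : F2 →* F2) =
        (MulAut.conj g⁻¹).toMonoidHom.comp (FreeGroup.lift ![gb, lt (0, d)]) := by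
      ext i
      fin_cases i <;> simp
    unfold IsBasis
    rw [this]
    exact (MulAut.conj g⁻¹).bijective.comp (basis_ba d)
  · unfold Vx; congr 1; group

theorem red_cons (S T : Subgroup F2) (p : List (Subgroup F2)) :
    IsReducedCPath (S :: T :: p) ↔ CRelS S T ∧ p.head? ≠ some S ∧ IsReducedCPath (T :: p) := by
  unfold IsReducedCPath List.Chain'
  rw [List.isChain_cons_cons]
  constructor
  · rintro ⟨⟨h1, h2⟩, h3⟩
    refine ⟨h1, ?_, h2, ?_⟩
    · cases p with
      | nil => simp
      | cons U p =>
        have := h3 0 (by simp)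
        simpa using this.symm
    · intro i hi
      have := h3 (i + 1) (by simp at hi ⊢; omega)
      simpa using this
  · rintro ⟨h1, h2, h3, h4⟩
    refine ⟨⟨h1, h3⟩, ?_⟩
    intro i hi
    cases i with
    | zero =>
      cases p with
      | nil => simp at hi
      | cons U p => simpa using fun h : S = U => h2 (by simp [h])
    | succ i =>
      have := h4 i (by simp at hi ⊢; omega)
      simpa using this

theorem aLength_one : aLength 1 = 0 := by simp [aLength]

theorem aLength_Vx (g h : F2) (e : Vx g = Vx h) : aLength g = aLength h := by
  obtain ⟨k, rfl⟩ := Vx_eq g h e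
  rw [aLength_b]

theorem path_len (n : ℕ) : ∀ (p : List (Subgroup F2)) (g : F2), p.length ≤ n →
    p.head? = some (Vx g) → p.getLast? = some (Vx 1) → IsReducedCPath p →
    p.length = aLength g + 1 := by
  induction n with
  | zero =>
    intro p g h0 hh
    rw [List.length_eq_zero_iff.1 (Nat.le_zero.1 h0)] at hh
    simp at hh
  | succ n ih =>
    intro p g hn hh hl hr
    cases p with
    | nil => simp at hh
    | cons S p =>
    simp only [List.length_cons] at hn
    simp only [List.head?_cons, Option.some.injEq] at hh
    subst hh
    cases p with
    | nil =>
      simp at hl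
      simp [aLength_Vx _ _ hl, aLength_one]
    | cons T q =>
      rw [red_cons] at hr
      obtain ⟨hC, hne, hr⟩ := hr
      rw [List.getLast?_cons_cons] at hl
      obtain ⟨d, k, rfl⟩ := C_out g T hC
      have hlen := ih _ _ (by omega) rfl hl hr
      rcases aLength_a d (gb ^ k * g) with ⟨-, h2⟩ | ⟨-, h2⟩
      · rw [aLength_b] at h2
        rw [List.length_cons, hlen]; omega
      · exfalso
        rw [aLength_b] at h2
        cases q with
        | nil => simp at hlen; omega
        | cons U q =>
          rw [red_cons] at hr
          obtain ⟨hC', hne', hr'⟩ := hr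
          obtain ⟨d', k', rfl⟩ := C_out _ U hC'
          have hlow : aLength (lt (0, d') * (gb ^ k' * (lt (0, d) * (gb ^ k * g)))) + 1 =
              aLength (lt (0, d) * (gb ^ k * g)) := by
            rcases aLength_a d' (gb ^ k' * (lt (0, d) * (gb ^ k * g))) with ⟨-, h3⟩ | ⟨-, h3⟩
            · rw [h3, aLength_b]
            · exfalso
              rw [aLength_b] at h3
              rw [List.getLast?_cons_cons] at hl
              have := ih _ _ (by simp at hn ⊢; omega) rfl hl hr'
              simp at hlen this
              omega
          obtain ⟨rfl, rfl⟩ := descent_unique (lt (0, d) * (gb ^ k * g)) d' (!d) k' 0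
            (by omega) (by rw [zpow_zero, one_mul, lt_cancel, aLength_b]; omega)
          apply hne
          rw [zpow_zero, one_mul, lt_cancel, Vx_b]; rfl

theorem path_unique (p : List (Subgroup F2)) : ∀ (q : List (Subgroup F2)) (g : F2),
    p.head? = some (Vx g) → p.getLast? = some (Vx 1) → IsReducedCPath p →
    q.head? = some (Vx g) → q.getLast? = some (Vx 1) → IsReducedCPath q → p = q := by
  induction p with
  | nil => simp
  | cons S p ih =>
    intro q g hh hl hr hh' hl' hr'
    have len := path_len _ _ _ le_rfl hh hl hr
    have len' := path_len _ _ _ le_rfl hh' hl' hr'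
    cases q with
    | nil => simp at hh'
    | cons S' q =>
    simp only [List.head?_cons, Option.some.injEq] at hh hh'
    subst hh hh'
    simp only [List.length_cons, Nat.add_right_cancel_iff] at len len'
    cases p with
    | nil =>
      have : q.length = 0 := by simp at len; omega
      rw [List.length_eq_zero_iff.1 this]
    | cons T p =>
      cases q with
      | nil => simp at len len'; omega
      | cons T' q =>
        rw [red_cons] at hr hr'
        rw [List.getLast?_cons_cons] at hl hl'
        obtain ⟨hC, -, hr⟩ := hr
        obtain ⟨hC', -, hr'⟩ := hr'
        obtain ⟨d, k, rfl⟩ := C_out g T hC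
        obtain ⟨d', k', rfl⟩ := C_out g T' hC'
        have l1 := path_len _ _ _ le_rfl rfl hl hr
        have l2 := path_len _ _ _ le_rfl rfl hl' hr'
        obtain ⟨rfl, rfl⟩ := descent_unique g d d' k k' (by omega) (by omega)
        rw [ih _ _ rfl hl hr rfl hl' hr']

theorem path_exists (n : ℕ) : ∀ g : F2, aLength g = n → ∃ p : List (Subgroup F2),
    p.head? = some (Vx g) ∧ p.getLast? = some (Vx 1) ∧ IsReducedCPath p := by
  induction n with
  | zero =>
    intro g hg
    obtain ⟨k, rfl⟩ := aLength_zero g hg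
    have := Vx_b k 1
    rw [mul_one] at this
    refine ⟨[Vx 1], by simp [this], rfl, ?_, ?_⟩
    · exact List.isChain_singleton _
    · intro i hi; simp at hi
  | succ n ih =>
    intro g hg
    obtain ⟨d, k, hd⟩ := exists_descent g (by omega)
    obtain ⟨p, hh, hl, hr⟩ := ih _ (by omega : aLength (lt (0, d) * (gb ^ k * g)) = n)
    have len := path_len _ _ _ le_rfl hh hl hr
    cases p with
    | nil => simp at hh
    | cons S p =>
      simp only [List.head?_cons, Option.some.injEq] at hh
      subst hh
      refine ⟨Vx g :: Vx (lt (0, d) * (gb ^ k * g)) :: p, rfl, ?_, ?_⟩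
      · rw [List.getLast?_cons_cons]; exact hl
      · rw [red_cons]
        refine ⟨?_, ?_, hr⟩
        · have := C_in (gb ^ k * g) d
          rwa [Vx_b] at this
        · intro hp
          cases p with
          | nil => simp at hp
          | cons U p =>
            rw [red_cons] at hr
            rw [List.getLast?_cons_cons] at hl
            have l2 := path_len _ _ _ le_rfl hp hl hr.2.2
            simp at len l2
            omega

theorem Vx_one : Vx 1 = zpowers gb := by simp [Vx]

/-- There is a unique reduced `C`-path from `⟨b^g⟩` to `⟨b⟩`, and it has length
`aLength g`; in particular the conjugacy class of `⟨b⟩` is a tree under `C`. -/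
theorem unique_reduced_C_path_to_b (g : F2) :
    (∃! p : List (Subgroup F2),
      p.length = aLength g + 1 ∧
      p.head? = some (zpowers (g⁻¹ * gb * g)) ∧
      p.getLast? = some (zpowers gb) ∧
      IsReducedCPath p) ∧
    (∀ p q : List (Subgroup F2),
      (p.head? = some (zpowers (g⁻¹ * gb * g)) ∧ p.getLast? = some (zpowers gb) ∧
        IsReducedCPath p) →
      (q.head? = some (zpowers (g⁻¹ * gb * g)) ∧ q.getLast? = some (zpowers gb) ∧
        IsReducedCPath q) →
      p = q) := by
  rw [← Vx_one]
  change (∃! p : List (Subgroup F2), p.length = aLength g + 1 ∧ p.head? = some (Vx g) ∧ _) ∧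
    (∀ p q : List (Subgroup F2), (p.head? = some (Vx g) ∧ _) → (q.head? = some (Vx g) ∧ _) → _)
  have huniq : ∀ p q : List (Subgroup F2),
      (p.head? = some (Vx g) ∧ p.getLast? = some (Vx 1) ∧ IsReducedCPath p) →
      (q.head? = some (Vx g) ∧ q.getLast? = some (Vx 1) ∧ IsReducedCPath q) → p = q :=
    fun p q ⟨h1, h2, h3⟩ ⟨h4, h5, h6⟩ => path_unique p q g h1 h2 h3 h4 h5 h6
  refine ⟨?_, huniq⟩
  obtain ⟨p, h1, h2, h3⟩ := path_exists _ g rfl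
  exact ⟨p, ⟨path_len _ _ _ le_rfl h1 h2 h3, h1, h2, h3⟩,
    fun q hq => huniq q p hq.2 ⟨h1, h2, h3⟩⟩
end

section
/- Let F_2 = ⟨a, b⟩ and write C_1(⟨b⟩) = B_1 ∪ B_2 where B_1 = { ⟨b^{a b^m}⟩ : m ∈ ℤ } and B_2 = { ⟨b^{a^{-1} b^m}⟩ : m ∈ ℤ }. Then two vertices x, y ∈ C_1(⟨b⟩) are parallel (their lines ℓ(⟨b⟩, x) and ℓ(⟨b⟩, y) are disjoint) if and only if x and y lie in the same set B_i. In particular, parallelism is an equivalence relation on C_1(⟨b⟩) with exactly two classes. -/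
open Subgroup

/-- The neighbors of a vertex of `AF₂`. -/
def D1 (S : Subgroup F2) : Set (Subgroup F2) :=
  {T | ∃ u v : F2, S = zpowers u ∧ T = zpowers v ∧ IsBasis u v}

/-- The line of a 1-conjugate pair: the set of common neighbors. -/
def line (S T : Subgroup F2) : Set (Subgroup F2) := D1 S ∩ D1 T

/-- The 1-conjugates of a vertex. -/
def C1 (S : Subgroup F2) : Set (Subgroup F2) :=
  {T | ∃ x z : F2, S = zpowers x ∧ IsBasis x z ∧ T = zpowers (z⁻¹ * x * z)}

def B1 : Set (Subgroup F2) :=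
  {S | ∃ m : ℤ, S = zpowers ((ga * gb ^ m)⁻¹ * gb * (ga * gb ^ m))}

def B2 : Set (Subgroup F2) :=
  {S | ∃ m : ℤ, S = zpowers ((ga⁻¹ * gb ^ m)⁻¹ * gb * (ga⁻¹ * gb ^ m))}

/-- The reduced word of `x` starts and ends with a letter of type `c`. -/
def SE (c : Fin 2) (x : F2) : Prop :=
  x.toWord.head?.map Prod.fst = some c ∧ x.toWord.getLast?.map Prod.fst = some c

theorem SE.inv {c : Fin 2} {x : F2} (h : SE c x) : SE c x⁻¹ := by
  obtain ⟨h1, h2⟩ := h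
  unfold SE
  rw [FreeGroup.toWord_inv]
  simp only [FreeGroup.invRev, List.head?_reverse, List.getLast?_reverse, List.head?_map,
    List.getLast?_map, Option.map_map]
  exact ⟨h2, h1⟩

theorem SE.pow {c : Fin 2} {x : F2} (h : SE c x) (n : ℕ) :
    SE c (x ^ (n + 1)) ∧ x.norm ≤ (x ^ (n + 1)).norm := by
  obtain ⟨h1, h2⟩ := h
  have hL := FreeGroup.reduceCyclically.conj_conjugator_reduceCyclically x.toWord
  have hw : (x ^ (n + 1)).toWord = _ :=
    (FreeGroup.toWord_pow x (n + 1)).trans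
      (FreeGroup.reduceCyclically.reduce_flatten_replicate_succ FreeGroup.isReduced_toWord n)
  unfold SE FreeGroup.norm
  rw [hw]
  generalize x.toWord = L at *
  generalize FreeGroup.reduceCyclically.conjugator L = C at *
  generalize FreeGroup.reduceCyclically L = R at *
  subst hL
  refine ⟨?_, ?_⟩
  · cases C with
    | nil =>
      simp only [List.nil_append, FreeGroup.invRev_empty, List.append_nil] at *
      rw [List.head?_flatten_replicate (by omega), List.getLast?_flatten_replicate (by omega)]
      exact ⟨h1, h2⟩
    | cons p C =>
      simp only [FreeGroup.invRev, List.map_cons, List.reverse_cons, ← List.append_assoc,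
        List.getLast?_concat, List.cons_append, List.head?_cons] at *
      rw [← List.cons_append, List.getLast?_concat] at *
      exact ⟨h1, h2⟩
  · simp
    nlinarith

theorem SE.zpow {c : Fin 2} {x : F2} (h : SE c x) (k : ℤ) (hk : k ≠ 0) :
    SE c (x ^ k) ∧ x.norm ≤ (x ^ k).norm := by
  rcases k with n | n
  · obtain ⟨m, rfl⟩ := Nat.exists_eq_succ_of_ne_zero (n := n) (by rintro rfl; exact hk rfl)
    have := h.pow m
    exact_mod_cast this
  · rw [zpow_negSucc, FreeGroup.norm_inv_eq]
    exact ⟨(h.pow n).1.inv, (h.pow n).2⟩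

theorem SE.toWord_mul {c d : Fin 2} (hcd : c ≠ d) {x y : F2} (h : SE c x)
    (hy : y = 1 ∨ y.toWord.head?.map Prod.fst = some d) :
    (x * y).toWord = x.toWord ++ y.toWord := by
  rw [FreeGroup.toWord_mul]
  apply FreeGroup.IsReduced.reduce_eq
  unfold FreeGroup.IsReduced
  rw [List.isChain_append]
  refine ⟨FreeGroup.isReduced_toWord, FreeGroup.isReduced_toWord, ?_⟩
  intro p hp q hq hpq
  exfalso
  have h2 := h.2
  rcases hy with rfl | hy
  · simp at hq
  · rw [Option.mem_def] at hp hq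
    rw [hp] at h2
    rw [hq] at hy
    simp at h2 hy
    exact hcd (h2 ▸ hy ▸ hpq)

inductive Alt_s12 (w : F2) : Fin 2 → F2 → Prop
  | one (c : Fin 2) : Alt_s12 w c 1
  | step (c d : Fin 2) (hcd : c ≠ d) (k : ℤ) (hk : k ≠ 0) (h : F2) (hh : Alt_s12 w d h) :
      Alt_s12 w c ((![w, gb] c) ^ k * h)

theorem Alt_s12.mul {w : F2} {c : Fin 2} {h : F2} (hh : Alt_s12 w c h) (e : Fin 2) (k : ℤ) :
    ∃ c', Alt_s12 w c' ((![w, gb] e) ^ k * h) := by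
  by_cases hk : k = 0
  · subst hk; exact ⟨c, by simpa using hh⟩
  by_cases hec : e = c
  · subst hec
    cases hh with
    | one =>
      exact ⟨e, Alt_s12.step e (e + 1) (by fin_cases e <;> decide) k hk 1 (Alt_s12.one _)⟩
    | step c d hcd k' hk' h' hh' =>
      rw [← mul_assoc, ← zpow_add]
      by_cases hs : k + k' = 0
      · rw [hs]; exact ⟨d, by simpa using hh'⟩
      · exact ⟨e, Alt_s12.step e d hcd _ hs h' hh'⟩
  · exact ⟨e, Alt_s12.step e c hec k hk h hh⟩

theorem alt_of_mem_s12 {w h : F2} (hh : h ∈ closure (Set.range ![w, gb])) : ∃ c, Alt_s12 w c h := by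
  induction hh using closure_induction_left with
  | one => exact ⟨0, Alt_s12.one _⟩
  | mul_left x hx y hy ih =>
    obtain ⟨e, rfl⟩ := hx
    obtain ⟨c, hc⟩ := ih
    simpa using hc.mul e 1
  | inv_mul_cancel x hx y hy ih =>
    obtain ⟨e, rfl⟩ := hx
    obtain ⟨c, hc⟩ := ih
    simpa using hc.mul e (-1)

theorem se_gb : SE 1 gb := by
  simp [SE, gb]

theorem Alt_s12.head {w : F2} (hw : SE 0 w) {c : Fin 2} {h : F2} (hh : Alt_s12 w c h) :
    h = 1 ∨ (h.toWord.head?.map Prod.fst = some c ∧ (c = 0 → w.norm ≤ h.norm)) := by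
  induction hh with
  | one c => exact Or.inl rfl
  | step c d hcd k hk h hh ih =>
    right
    have hg : SE c ((![w, gb] c) ^ k) ∧ (![w, gb] c).norm ≤ ((![w, gb] c) ^ k).norm := by
      fin_cases c
      · exact hw.zpow k hk
      · exact se_gb.zpow k hk
    have hm := hg.1.toWord_mul hcd (y := h) (ih.imp id fun h => h.1)
    have h1 := hg.1.1
    constructor
    · rw [hm, List.head?_append]
      rcases hq : (((![w, gb] c) ^ k).toWord.head?) with _ | q
      · rw [hq] at h1; simp at h1
      · rw [hq] at h1; simpa using h1
    · rintro rfl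
      have := hg.2
      unfold FreeGroup.norm at *
      rw [hm, List.length_append]
      simp at this ⊢
      omega

theorem norm_le_one {w : F2} (hw : SE 0 w) (h : ga ∈ closure (Set.range ![w, gb])) :
    w.norm ≤ 1 := by
  obtain ⟨c, hc⟩ := alt_of_mem_s12 h
  rcases hc.head hw with h1 | ⟨h1, h2⟩
  · exact absurd h1 (FreeGroup.of_ne_one _)
  · have : c = 0 := by simpa [ga, eq_comm] using h1
    simpa [ga] using h2 this

/-- Multiplying by the inverse of the first letter shortens. -/
theorem norm_lt_of_head {w : F2} {s : Bool} (h : w.toWord.head? = some (1, s)) :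
    ∃ k : ℤ, (gb ^ k * w).norm < w.norm := by
  rcases hL : w.toWord with _ | ⟨p, L⟩
  · simp [hL] at h
  · rw [hL] at h
    simp at h
    subst h
    have hw : w = FreeGroup.mk [(1, s)] * FreeGroup.mk L := by
      rw [FreeGroup.mul_mk, ← FreeGroup.mk_toWord (x := w), hL]; rfl
    have h2 : ∃ k : ℤ, gb ^ k = (FreeGroup.mk [(1, s)])⁻¹ := by
      cases s
      · exact ⟨1, by simp [gb, FreeGroup.of, FreeGroup.invRev]⟩
      · exact ⟨-1, by simp [gb, FreeGroup.of]⟩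
    obtain ⟨k, hk⟩ := h2
    refine ⟨k, ?_⟩
    have h3 : gb ^ k * w = FreeGroup.mk L := by rw [hk, hw]; group
    rw [h3]
    have := FreeGroup.norm_mk_le (L₁ := L)
    have h4 : w.norm = L.length + 1 := by rw [FreeGroup.norm, hL]; simp
    omega

theorem head_zero_of_min {w : F2} (hw : w ≠ 1)
    (hmin : ∀ k : ℤ, w.norm ≤ (gb ^ k * w).norm) :
    w.toWord.head?.map Prod.fst = some 0 := by
  rcases hL : w.toWord.head? with _ | ⟨c, s⟩
  · simp at hL; exact absurd hL hw
  · by_cases hc : c = 1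
    · subst hc
      obtain ⟨k, hk⟩ := norm_lt_of_head hL
      have := hmin k
      omega
    · simp; omega

def expA : F2 →* Multiplicative ℤ := FreeGroup.lift ![Multiplicative.ofAdd 1, 1]

theorem expA_ga : expA ga = Multiplicative.ofAdd 1 := by simp [expA, ga]
theorem expA_gb : expA gb = 1 := by simp [expA, gb]

theorem form_of_closure {z : F2} (h : ga ∈ closure (Set.range ![z, gb])) :
    ∃ i j : ℤ, z = gb ^ i * ga * gb ^ j ∨ z = gb ^ i * ga⁻¹ * gb ^ j := by
  obtain ⟨⟨i, j⟩, hij⟩ : ∃ p : ℤ × ℤ, ∀ q : ℤ × ℤ,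
      (gb ^ p.1 * z * gb ^ p.2).norm ≤ (gb ^ q.1 * z * gb ^ q.2).norm := by
    let f : ℤ × ℤ → ℕ := fun q => (gb ^ q.1 * z * gb ^ q.2).norm
    exact ⟨Function.argmin f, fun q => Function.argmin_le f q⟩
  set w := gb ^ i * z * gb ^ j with hw
  have hz : z = gb ^ (-i) * w * gb ^ (-j) := by rw [hw]; group
  have hga : ga ∈ closure (Set.range ![w, gb]) := by
    refine (closure_le _).2 ?_ h
    have hw' : w ∈ closure (Set.range ![w, gb]) := subset_closure ⟨0, rfl⟩
    have hb' : gb ∈ closure (Set.range ![w, gb]) := subset_closure ⟨1, rfl⟩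
    rintro _ ⟨e, rfl⟩
    fin_cases e
    · change z ∈ Subgroup.closure _
      rw [hz]
      exact mul_mem (mul_mem (zpow_mem hb' _) hw') (zpow_mem hb' _)
    · exact hb'
  have hw1 : w ≠ 1 := by
    intro h1
    have : closure (Set.range ![w, gb]) ≤ expA.ker := by
      rw [closure_le]
      rintro _ ⟨e, rfl⟩
      fin_cases e
      · simp [h1]
      · simp [MonoidHom.mem_ker, expA_gb]
    have := this hga
    rw [MonoidHom.mem_ker, expA_ga] at this
    exact absurd this (by decide)
  have hse : SE 0 w := by
    constructor
    · apply head_zero_of_min hw1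
      intro k
      have := hij (k + i, j)
      simp only [zpow_add] at this
      have e : gb ^ k * w = gb ^ k * gb ^ i * z * gb ^ j := by rw [hw]; group
      rw [e]
      exact this
    · have := head_zero_of_min (w := w⁻¹) (by simpa using hw1) (by
        intro k
        have := hij (i, j - k)
        rw [FreeGroup.norm_inv_eq, ← FreeGroup.norm_inv_eq (x := gb ^ k * w⁻¹)]
        have e : (gb ^ k * w⁻¹)⁻¹ = gb ^ i * z * gb ^ (j - k) := by rw [hw]; group
        rw [e]
        exact this)
      rw [FreeGroup.toWord_inv] at this
      simpa [FreeGroup.invRev, Function.comp_def] using this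
  have hn := norm_le_one hse hga
  refine ⟨-i, -j, ?_⟩
  have h1 := hse.1
  have hm := FreeGroup.mk_toWord (x := w)
  unfold FreeGroup.norm at hn
  rcases hL : w.toWord with _ | ⟨⟨c, s⟩, L⟩
  · rw [hL] at h1; simp at h1
  · rw [hL] at h1 hn hm
    simp at h1 hn
    subst h1 hn
    cases s
    · right
      rw [hz]
      congr 2
      rw [← hm]
      simp [ga, FreeGroup.of, FreeGroup.invRev]
    · left
      rw [hz]
      congr 2
      exact hm.symm

theorem isBasis_of_inv {x y : F2} (ψ : F2 →* F2) (h1 : ψ x = ga) (h2 : ψ y = gb)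
    (h3 : FreeGroup.lift ![x, y] (ψ ga) = ga) (h4 : FreeGroup.lift ![x, y] (ψ gb) = gb) :
    IsBasis x y := by
  have e1 : ψ.comp (FreeGroup.lift ![x, y]) = MonoidHom.id _ := by
    ext i; fin_cases i
    · simpa [ga] using h1
    · simpa [gb] using h2
  have e2 : (FreeGroup.lift ![x, y]).comp ψ = MonoidHom.id _ := by
    ext i; fin_cases i
    · exact h3
    · exact h4
  exact Function.bijective_iff_has_inverse.2 ⟨ψ, DFunLike.congr_fun e1, DFunLike.congr_fun e2⟩

theorem lift_ga (x y : F2) : FreeGroup.lift ![x, y] ga = x := by simp [ga]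
theorem lift_gb (x y : F2) : FreeGroup.lift ![x, y] gb = y := by simp [gb]

theorem basis_pos (i j : ℤ) : IsBasis gb (gb ^ i * ga * gb ^ j) := by
  refine isBasis_of_inv (FreeGroup.lift ![ga ^ (-i) * gb * ga ^ (-j), ga]) ?_ ?_ ?_ ?_ <;>
  simp only [map_mul, map_zpow, lift_ga, lift_gb] <;> group

theorem basis_neg (i j : ℤ) : IsBasis gb (gb ^ i * ga⁻¹ * gb ^ j) := by
  refine isBasis_of_inv (FreeGroup.lift ![ga ^ j * gb⁻¹ * ga ^ i, ga]) ?_ ?_ ?_ ?_ <;>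
  simp only [map_mul, map_zpow, map_inv, lift_ga, lift_gb] <;> group

theorem IsBasis.conj {x y : F2} (h : IsBasis x y) (g : F2) :
    IsBasis (g⁻¹ * x * g) (g⁻¹ * y * g) := by
  have e : (FreeGroup.lift ![g⁻¹ * x * g, g⁻¹ * y * g] : F2 →* F2) =
      (MulAut.conj g⁻¹).toMonoidHom.comp (FreeGroup.lift ![x, y]) := by
    ext i; fin_cases i <;> simp
  unfold IsBasis
  rw [e]
  exact (MulAut.conj g⁻¹).bijective.comp h

theorem zpowers_conj {x y : F2} (h : zpowers x = zpowers y) (g : F2) :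
    zpowers (g⁻¹ * x * g) = zpowers (g⁻¹ * y * g) := by
  have e : ∀ x : F2, zpowers (g⁻¹ * x * g) = (zpowers x).map (MulAut.conj g⁻¹).toMonoidHom := by
    intro x
    rw [MonoidHom.map_zpowers]
    simp
  rw [e, e, h]

theorem form_of_basis {x z : F2} (hx : zpowers gb = zpowers x) (h : IsBasis x z) :
    ∃ i j : ℤ, z = gb ^ i * ga * gb ^ j ∨ z = gb ^ i * ga⁻¹ * gb ^ j := by
  apply form_of_closure
  have h1 := FreeGroup.lift_surjective_iff_closure_range_eq_top.1 h.2
  have h2 : ga ∈ Subgroup.closure (Set.range ![x, z]) := h1 ▸ mem_top _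
  refine (closure_le _).2 ?_ h2
  have hb' : gb ∈ Subgroup.closure (Set.range ![z, gb]) := subset_closure ⟨1, rfl⟩
  have hz' : z ∈ Subgroup.closure (Set.range ![z, gb]) := subset_closure ⟨0, rfl⟩
  rintro _ ⟨e, rfl⟩
  fin_cases e
  · have : x ∈ zpowers gb := hx ▸ mem_zpowers x
    exact (zpowers_le.2 hb') this
  · exact hz'

theorem D1_gb {T : Subgroup F2} (h : T ∈ D1 (zpowers gb)) :
    ∃ i j : ℤ, T = zpowers (gb ^ i * ga * gb ^ j) := by
  obtain ⟨u, v, hu, rfl, hb⟩ := h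
  obtain ⟨i, j, rfl | rfl⟩ := form_of_basis hu hb
  · exact ⟨i, j, rfl⟩
  · refine ⟨-j, -i, ?_⟩
    rw [← zpowers_inv]
    congr 1
    group

theorem D1_conj {v g : F2} (h : zpowers v ∈ D1 (zpowers (g⁻¹ * gb * g))) :
    zpowers (g * v * g⁻¹) ∈ D1 (zpowers gb) := by
  obtain ⟨u, v', hu, hv, hb⟩ := h
  refine ⟨g * u * g⁻¹, g * v' * g⁻¹, ?_, ?_, ?_⟩
  · have := zpowers_conj hu g⁻¹
    rw [← inv_inv g, inv_inv g⁻¹, ← this]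
    congr 1
    group
  · simpa using zpowers_conj hv g⁻¹
  · simpa using hb.conj g⁻¹

theorem D1_conj' {v g : F2} (h : IsBasis gb (g * v * g⁻¹)) :
    zpowers v ∈ D1 (zpowers (g⁻¹ * gb * g)) := by
  refine ⟨_, v, rfl, rfl, ?_⟩
  have := h.conj g
  have e : g⁻¹ * (g * v * g⁻¹) * g = v := by group
  rwa [e] at this

def aff (t : ℚ) (ht : t ≠ 0) : F2 →* Equiv.Perm ℚ :=
  FreeGroup.lift ![Equiv.mulLeft₀ t ht, Equiv.addRight 1]

theorem aff_ga (t : ℚ) (ht : t ≠ 0) (x : ℚ) : aff t ht ga x = t * x := by simp [aff, ga]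

theorem aff_gb (t : ℚ) (ht : t ≠ 0) (k : ℤ) (x : ℚ) : aff t ht (gb ^ k) x = x + k := by
  simp [aff, gb]

theorem expA_form {p : F2} {k l : ℤ} (h : zpowers p = zpowers (gb ^ k * ga * gb ^ l))
    (hp : expA p = Multiplicative.ofAdd 1) : p = gb ^ k * ga * gb ^ l := by
  have : p ∈ zpowers (gb ^ k * ga * gb ^ l) := h ▸ mem_zpowers p
  obtain ⟨n, rfl⟩ := this
  simp only [map_zpow, map_mul, expA_ga, expA_gb, one_zpow, one_mul, mul_one] at hp
  rw [← ofAdd_zsmul] at hp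
  have : n = 1 := by simpa using hp
  simp [this]

theorem eq_pos {p q k l : ℤ}
    (h : ga * gb ^ p * ga * gb ^ q = gb ^ k * ga * gb ^ l * ga) : q = 0 := by
  have key : ∀ (t : ℚ) (ht : t ≠ 0), t * (t * q + p) = t * l + k := by
    intro t ht
    have := congrArg (fun g => aff t ht g 0) h
    simp only [map_mul, Equiv.Perm.mul_apply] at this
    simpa only [aff_ga, aff_gb, zero_add, mul_zero] using this
  have h1 := key 1 (by norm_num)
  have h2 := key 2 (by norm_num)
  have h3 := key 3 (by norm_num)
  have : (q : ℚ) = 0 := by linarith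
  exact_mod_cast this

theorem eq_neg {p q k l : ℤ}
    (h : gb ^ p * ga * gb ^ q * ga = ga * gb ^ k * ga * gb ^ l) : p = 0 := by
  have key : ∀ (t : ℚ) (ht : t ≠ 0), t * (t * l + k) = t * q + p := by
    intro t ht
    have := congrArg (fun g => aff t ht g 0) h
    simp only [map_mul, Equiv.Perm.mul_apply] at this
    simpa only [aff_ga, aff_gb, zero_add, mul_zero] using this.symm
  have h1 := key 1 (by norm_num)
  have h2 := key 2 (by norm_num)
  have h3 := key 3 (by norm_num)
  have : (p : ℚ) = 0 := by linarith
  exact_mod_cast this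

theorem line_pos {i j m : ℤ}
    (h : zpowers (gb ^ i * ga * gb ^ j) ∈ D1 (zpowers ((ga * gb ^ m)⁻¹ * gb * (ga * gb ^ m)))) :
    j = m := by
  obtain ⟨k, l, hkl⟩ := D1_gb (D1_conj h)
  have e := expA_form hkl (by
    simp only [map_zpow, map_mul, map_inv, expA_ga, expA_gb, one_zpow, one_mul, mul_one]; rfl)
  have : j - m = 0 := by
    apply eq_pos (p := m + i) (k := k) (l := l)
    rw [← e]; group
  omega

theorem line_neg {i j m : ℤ}
    (h : zpowers (gb ^ i * ga * gb ^ j) ∈ D1 (zpowers ((ga⁻¹ * gb ^ m)⁻¹ * gb * (ga⁻¹ * gb ^ m)))) :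
    i = -m := by
  obtain ⟨k, l, hkl⟩ := D1_gb (D1_conj h)
  have e := expA_form hkl (by
    simp only [map_zpow, map_mul, map_inv, expA_ga, expA_gb, one_zpow, one_mul, mul_one]; rfl)
  have : m + i = 0 := by
    apply eq_neg (q := j - m) (k := k) (l := l)
    have e' : ga * gb ^ k * ga * gb ^ l = ga * (gb ^ k * ga * gb ^ l) := by group
    rw [e', ← e]; group
  omega

theorem meet (m n : ℤ) : zpowers (gb ^ (-n) * ga * gb ^ m) ∈
    line (zpowers gb) (zpowers ((ga * gb ^ m)⁻¹ * gb * (ga * gb ^ m))) ∩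
    line (zpowers gb) (zpowers ((ga⁻¹ * gb ^ n)⁻¹ * gb * (ga⁻¹ * gb ^ n))) := by
  have h0 : zpowers (gb ^ (-n) * ga * gb ^ m) ∈ D1 (zpowers gb) :=
    ⟨gb, _, rfl, rfl, basis_pos _ _⟩
  refine ⟨⟨h0, D1_conj' ?_⟩, ⟨h0, D1_conj' ?_⟩⟩
  · convert basis_pos 0 (m - n) using 1
    group
  · convert basis_pos (m - n) 0 using 1
    group

theorem C1_eq : C1 (zpowers gb) = B1 ∪ B2 := by
  ext T
  constructor
  · rintro ⟨x, z, hx, hb, rfl⟩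
    rw [← zpowers_conj hx z]
    obtain ⟨i, j, rfl | rfl⟩ := form_of_basis hx hb
    · left
      refine ⟨j, ?_⟩
      congr 1
      group
    · right
      refine ⟨j, ?_⟩
      congr 1
      group
  · rintro (⟨m, rfl⟩ | ⟨m, rfl⟩)
    · exact ⟨gb, ga * gb ^ m, rfl, by simpa using basis_pos 0 m, rfl⟩
    · exact ⟨gb, ga⁻¹ * gb ^ m, rfl, by simpa using basis_neg 0 m, rfl⟩

/-- `C₁(⟨b⟩) = B₁ ∪ B₂`, and `x, y ∈ C₁(⟨b⟩)` are parallel (their lines through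
`⟨b⟩` are disjoint) iff they lie in the same `Bᵢ`. -/
theorem parallel_iff_same_class :
    C1 (zpowers gb) = B1 ∪ B2 ∧
    ∀ x ∈ C1 (zpowers gb), ∀ y ∈ C1 (zpowers gb), x ≠ y →
      ((line (zpowers gb) x ∩ line (zpowers gb) y = ∅) ↔
        ((x ∈ B1 ∧ y ∈ B1) ∨ (x ∈ B2 ∧ y ∈ B2))) := by
  refine ⟨C1_eq, ?_⟩
  rw [C1_eq]
  intro x hx y hy hxy
  constructor
  · intro hd
    rcases hx with hx | hx <;> rcases hy with hy | hy
    · exact Or.inl ⟨hx, hy⟩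
    · obtain ⟨m, rfl⟩ := hx
      obtain ⟨n, rfl⟩ := hy
      exact absurd (meet m n) (by rw [hd]; simp)
    · obtain ⟨m, rfl⟩ := hx
      obtain ⟨n, rfl⟩ := hy
      exact absurd (meet n m) (by rw [Set.inter_comm, hd]; simp)
    · exact Or.inr ⟨hx, hy⟩
  · intro h
    rw [Set.eq_empty_iff_forall_notMem]
    rintro T ⟨⟨h0, h1⟩, -, h2⟩
    obtain ⟨i, j, rfl⟩ := D1_gb h0
    rcases h with ⟨⟨m, rfl⟩, ⟨n, rfl⟩⟩ | ⟨⟨m, rfl⟩, ⟨n, rfl⟩⟩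
    · have e1 := line_pos h1
      have e2 := line_pos h2
      exact hxy (by rw [← e1, ← e2])
    · have e1 := line_neg h1
      have e2 := line_neg h2
      have e3 : m = n := by omega
      exact hxy (by rw [e3])
end

section
/- If x and y are vertices of AF_2 such that E(x, y) holds (they form a basis pair), then x and y are not conjugate in F_2. -/
open Subgroup

/-- If `E(⟨x⟩, ⟨y⟩)` holds (i.e. `{x, y}` is a basis of `F2`), then `⟨x⟩` and
`⟨y⟩` are not conjugate in `F2`. -/
theorem edge_implies_not_conjugate (x y : F2) (hxy : IsBasis x y) :
    ¬ ∃ g : F2, zpowers y = zpowers (g * x * g⁻¹) := by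
  rintro ⟨g, hg⟩
  let e : F2 ≃* F2 := MulEquiv.ofBijective (FreeGroup.lift ![x, y]) hxy
  let φ : F2 →* Multiplicative ℤ :=
    (FreeGroup.lift ![1, Multiplicative.ofAdd (1 : ℤ)]).comp e.symm.toMonoidHom
  have ex : e.symm x = FreeGroup.of 0 := by
    rw [MulEquiv.symm_apply_eq]
    change x = FreeGroup.lift ![x, y] (FreeGroup.of 0)
    simp
  have ey : e.symm y = FreeGroup.of 1 := by
    rw [MulEquiv.symm_apply_eq]
    change y = FreeGroup.lift ![x, y] (FreeGroup.of 1)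
    simp
  have hx : φ x = 1 := by simp [φ, ex]
  have hy : φ y = Multiplicative.ofAdd (1 : ℤ) := by simp [φ, ey]
  have hm : y ∈ zpowers (g * x * g⁻¹) := hg ▸ mem_zpowers y
  obtain ⟨n, hn⟩ := mem_zpowers_iff.mp hm
  have h1 : φ y = 1 := by
    rw [← hn, map_zpow, map_mul, map_mul, hx, map_inv]; simp
  rw [hy] at h1
  exact absurd (congrArg Multiplicative.toAdd h1) (by simp)
end
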